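/- arXiv:1705.04864 — 5 statements merged into one kernel-verified Lean document; each statement's English description precedes it below -/
import Mathlib

section
/- Let d ≥ 3 and let w be a weight on S^{d-1} normalized by w(S^{d-1}) = 1 with w(B) > 0 for every nonempty spherical cap B. If N is a positive integer such that N/2^{d-2} is an integer and N ≥ 1/w(B(x, 10^{-d})) for every x ∈ S^{d-1}, then there exists a finite collection {T_1, …, T_m} of admissible geodesic simplexes in S^{d-1} with pairwise disjoint interiors whose union is S^{d-1}, such that N·w(T_j) is a positive integer for every 1 ≤ j ≤ m. -/
open MeasureTheory Real Set
open scoped InnerProductSpace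

noncomputable section

variable {d : ℕ}

/-- The unit sphere `S^{d-1}` of `ℝ^d`. -/
def unitSphere (d : ℕ) : Set (EuclideanSpace ℝ (Fin d)) :=
  Metric.sphere (0 : EuclideanSpace ℝ (Fin d)) 1

/-- The geodesic distance `dist(x,y) = arccos (x ⬝ y)`. -/
def gdist (x y : EuclideanSpace ℝ (Fin d)) : ℝ := Real.arccos ⟪x, y⟫_ℝ

/-- The spherical cap with center `x` and radius `r`. -/
def cap (x : EuclideanSpace ℝ (Fin d)) (r : ℝ) : Set (EuclideanSpace ℝ (Fin d)) :=
  {y ∈ unitSphere d | gdist x y ≤ r}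

/-- The surface Lebesgue measure on the unit sphere, realized as the
`(d-1)`-dimensional Hausdorff measure restricted to the sphere. -/
def sphMeasure (d : ℕ) : Measure (EuclideanSpace ℝ (Fin d)) :=
  (Measure.hausdorffMeasure ((d : ℝ) - 1)).restrict (unitSphere d)

/-- `w(A) = ∫_A w dσ_d`. -/
def wMass (w : EuclideanSpace ℝ (Fin d) → ℝ) (A : Set (EuclideanSpace ℝ (Fin d))) : ℝ :=
  ∫ x in A, w x ∂(sphMeasure d)

/-- Evaluation of a `d`-variate real polynomial at a point of `ℝ^d`. -/
def pEval (P : MvPolynomial (Fin d) ℝ) (x : EuclideanSpace ℝ (Fin d)) : ℝ :=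
  MvPolynomial.eval (fun i => x i) P

/-- The geodesic arc joining `x` and `y`. -/
def arcSeg (x y : EuclideanSpace ℝ (Fin d)) : Set (EuclideanSpace ℝ (Fin d)) :=
  {z ∈ unitSphere d | ∃ t₁ t₂ : ℝ, 0 ≤ t₁ ∧ 0 ≤ t₂ ∧ z = t₁ • x + t₂ • y}

/-- Geodesic convexity of a subset of the sphere. -/
def GeoConvex (A : Set (EuclideanSpace ℝ (Fin d))) : Prop :=
  ∀ x ∈ A, ∀ y ∈ A, arcSeg x y ⊆ A

/-- The interior of a subset of the sphere relative to the sphere. -/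
def sphInterior (A : Set (EuclideanSpace ℝ (Fin d))) : Set (EuclideanSpace ℝ (Fin d)) :=
  {x ∈ A | ∃ ε : ℝ, 0 < ε ∧ Metric.ball x ε ∩ unitSphere d ⊆ A}

/-- The geodesic simplex spanned by `ξ 0, …, ξ (d-1)`. -/
def geodSimplex (ξ : Fin d → EuclideanSpace ℝ (Fin d)) :
    Set (EuclideanSpace ℝ (Fin d)) :=
  {z | ∃ t : Fin d → ℝ, (∀ j, 0 ≤ t j) ∧ (∑ j, t j) = 1 ∧
    z = ‖∑ j, t j • ξ j‖⁻¹ • ∑ j, t j • ξ j}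

/-- An admissible family `ξ 0, …, ξ (d-1)` of points of the sphere (the indices
`0, 1, …, d-1` correspond to `ξ_1, ξ_2, …, ξ_d` in the paper). -/
def Admissible (ξ : Fin d → EuclideanSpace ℝ (Fin d)) : Prop :=
  LinearIndependent ℝ ξ ∧ (∀ j, ξ j ∈ unitSphere d) ∧
  (∀ i j : Fin d, 1 ≤ (i : ℕ) → 1 ≤ (j : ℕ) → i ≠ j → ⟪ξ i, ξ j⟫_ℝ = 0) ∧
  (∀ i j : Fin d, (i : ℕ) = 0 → (j : ℕ) = 1 →
    Real.arccos ⟪ξ i, ξ j⟫_ℝ ∈ Set.Icc (π / 6) (π / 2)) ∧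
  (∀ i j : Fin d, (i : ℕ) = 0 → 2 ≤ (j : ℕ) → ⟪ξ i, ξ j⟫_ℝ = 0)

/-- A strongly `ε`-separated family of points of the sphere. -/
def StronglySep (ε : ℝ) (η : Fin d → EuclideanSpace ℝ (Fin d)) : Prop :=
  Function.Injective η ∧ (∀ j, η j ∈ unitSphere d) ∧
  ∀ j : Fin d, ∀ y ∈ Submodule.span ℝ (η '' {i | i ≠ j}), ε ≤ ‖η j - y‖

/-- The reflection negating the last coordinate. -/
def lastNeg (d : ℕ) (x : EuclideanSpace ℝ (Fin d)) : EuclideanSpace ℝ (Fin d) :=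
  (EuclideanSpace.equiv (Fin d) ℝ).symm fun i => if (i : ℕ) = d - 1 then -(x i) else x i

/-- The gradient of a `d`-variate polynomial, as a vector of `ℝ^d`. -/
def polyGrad (P : MvPolynomial (Fin d) ℝ) (x : EuclideanSpace ℝ (Fin d)) :
    EuclideanSpace ℝ (Fin d) :=
  (EuclideanSpace.equiv (Fin d) ℝ).symm fun i =>
    MvPolynomial.eval (fun j => x j) (MvPolynomial.pderiv i P)

/-- The tangential gradient `∇₀P(x) = ∇P(x) − (x⬝∇P(x))·x`. -/
def tGrad (P : MvPolynomial (Fin d) ℝ) (x : EuclideanSpace ℝ (Fin d)) :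
    EuclideanSpace ℝ (Fin d) :=
  polyGrad P x - ⟪x, polyGrad P x⟫_ℝ • x

/-- The affine hyperplane through the points `ξ j`. -/
def hplane (ξ : Fin d → EuclideanSpace ℝ (Fin d)) : Set (EuclideanSpace ℝ (Fin d)) :=
  (affineSpan ℝ (Set.range ξ) : Set (EuclideanSpace ℝ (Fin d)))

/-- The ball `B(x,r)_H = {y ∈ H : ‖x − y‖ ≤ r}` in a hyperplane `H`. -/
def ballH (H : Set (EuclideanSpace ℝ (Fin d))) (x : EuclideanSpace ℝ (Fin d)) (r : ℝ) :
    Set (EuclideanSpace ℝ (Fin d)) :=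
  {y ∈ H | ‖x - y‖ ≤ r}

/-- `w(A) = ∫_A w` with respect to `(d−1)`-dimensional Hausdorff (surface) measure. -/
def hMass (w : EuclideanSpace ℝ (Fin d) → ℝ) (A : Set (EuclideanSpace ℝ (Fin d))) : ℝ :=
  ∫ x in A, w x ∂(Measure.hausdorffMeasure ((d : ℝ) - 1))

/-- The interior of `A` relative to a hyperplane `H`. -/
def hInterior (H A : Set (EuclideanSpace ℝ (Fin d))) : Set (EuclideanSpace ℝ (Fin d)) :=
  {x ∈ A | ∃ ε : ℝ, 0 < ε ∧ Metric.ball x ε ∩ H ⊆ A}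

theorem norm_sub_le_gdist {x y : EuclideanSpace ℝ (Fin d)} (hx : x ∈ unitSphere d)
    (hy : y ∈ unitSphere d) : ‖x - y‖ ≤ gdist x y := by
  have hx1 : ‖x‖ = 1 := by simpa [unitSphere] using hx
  have hy1 : ‖y‖ = 1 := by simpa [unitSphere] using hy
  have hb := abs_le.1 (abs_real_inner_le_norm x y)
  rw [hx1, hy1] at hb
  have hc : Real.cos (gdist x y) = ⟪x, y⟫_ℝ :=
    Real.cos_arccos (by linarith [hb.1]) (by linarith [hb.2])
  have h1 := Real.one_sub_sq_div_two_le_cos (x := gdist x y)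
  have h2 : ‖x - y‖ ^ 2 = 2 - 2 * ⟪x, y⟫_ℝ := by
    rw [norm_sub_sq_real, hx1, hy1]; ring
  exact le_of_sq_le_sq (by linarith) (Real.arccos_nonneg _)

theorem sphMeasure_hyperplane {v : EuclideanSpace ℝ (Fin d)} (hv : v ≠ 0) :
    sphMeasure d {x | ⟪v, x⟫_ℝ = 0} = 0 := by
  have hd : 0 < d := by
    rcases Nat.eq_zero_or_pos d with rfl | h
    · exact absurd (Subsingleton.elim v 0) hv
    · exact h
  have hrank : Module.finrank ℝ (ℝ ∙ v)ᗮ = d - 1 := by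
    have h := Submodule.finrank_add_finrank_orthogonal (ℝ ∙ v)
    rw [finrank_span_singleton hv, finrank_euclideanSpace_fin] at h
    omega
  have hset : {x | ⟪v, x⟫_ℝ = 0} ∩ unitSphere d =
      (fun x : (ℝ ∙ v)ᗮ => (x : EuclideanSpace ℝ (Fin d))) '' Metric.sphere 0 1 := by
    ext x
    simp only [mem_inter_iff, mem_ofPred_eq, unitSphere, mem_sphere_zero_iff_norm, mem_image,
      Subtype.exists, Submodule.mem_orthogonal_singleton_iff_inner_right]
    constructor
    · rintro ⟨h1, h2⟩
      exact ⟨x, h1, by simpa using h2, rfl⟩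
    · rintro ⟨y, h1, h2, rfl⟩
      exact ⟨h1, by simpa using h2⟩
  have hmeas : MeasurableSet {x : EuclideanSpace ℝ (Fin d) | ⟪v, x⟫_ℝ = 0} :=
    (isClosed_eq (by fun_prop) continuous_const).measurableSet
  rw [sphMeasure, Measure.restrict_apply hmeas, hset,
    isometry_subtype_coe.hausdorffMeasure_image (Or.inl ?_)]
  · have h1 : ((d : ℝ) - 1) = (Module.finrank ℝ (ℝ ∙ v)ᗮ : ℝ) := by
      rw [hrank, Nat.cast_sub hd]; simp
    rw [h1]
    exact Measure.addHaar_sphere_of_ne_zero _ _ one_ne_zero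
  · have : (1 : ℝ) ≤ d := by exact_mod_cast hd
    linarith

theorem continuousAt_wMass_inter_nonneg {w : EuclideanSpace ℝ (Fin d) → ℝ}
    (hwi : Integrable w (sphMeasure d)) {A : Set (EuclideanSpace ℝ (Fin d))}
    (hA : MeasurableSet A) {h : ℝ → EuclideanSpace ℝ (Fin d) → ℝ}
    (hm : ∀ t, Measurable (h t)) (hc : ∀ x, Continuous fun t => h t x) (t₀ : ℝ)
    (h0 : sphMeasure d {x | h t₀ x = 0} = 0) :
    ContinuousAt (fun t => wMass w (A ∩ {x | 0 ≤ h t x})) t₀ := by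
  have hms : ∀ t, MeasurableSet (A ∩ {x | 0 ≤ h t x}) := fun t =>
    hA.inter (measurableSet_le measurable_const (hm t))
  simp only [ContinuousAt, wMass, ← integral_indicator (hms _)]
  refine tendsto_integral_filter_of_dominated_convergence (fun x => ‖w x‖)
    (Filter.Eventually.of_forall fun t => (hwi.indicator (hms t)).aestronglyMeasurable)
    (Filter.Eventually.of_forall fun t => Filter.Eventually.of_forall fun x =>
      norm_indicator_le_norm_self w x) hwi.norm ?_
  have hae : ∀ᵐ x ∂(sphMeasure d), h t₀ x ≠ 0 := by
    rw [ae_iff]; simpa using h0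
  filter_upwards [hae] with x hx
  refine tendsto_const_nhds.congr' ?_
  rcases lt_or_gt_of_ne hx with hx | hx
  · filter_upwards [(hc x).continuousAt.eventually_lt continuousAt_const hx] with t ht
    rw [indicator_of_notMem fun h => h.2.not_gt hx, indicator_of_notMem fun h => h.2.not_gt ht]
  · filter_upwards [continuousAt_const.eventually_lt (hc x).continuousAt hx] with t ht
    by_cases hxA : x ∈ A
    · have h1 : x ∈ A ∩ {x | 0 ≤ h t₀ x} := ⟨hxA, hx.le⟩
      have h2 : x ∈ A ∩ {x | 0 ≤ h t x} := ⟨hxA, ht.le⟩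
      rw [indicator_of_mem h1, indicator_of_mem h2]
    · rw [indicator_of_notMem fun h => hxA h.1, indicator_of_notMem fun h => hxA h.1]

theorem wMass_mono {w : EuclideanSpace ℝ (Fin d) → ℝ} (hw0 : ∀ x, 0 ≤ w x)
    (hwi : Integrable w (sphMeasure d)) {A B : Set (EuclideanSpace ℝ (Fin d))} (h : A ⊆ B) :
    wMass w A ≤ wMass w B :=
  setIntegral_mono_set hwi.integrableOn (Filter.Eventually.of_forall hw0) h.eventuallyLE

theorem wMass_union_of_null {w : EuclideanSpace ℝ (Fin d) → ℝ}
    (hwi : Integrable w (sphMeasure d)) {A B : Set (EuclideanSpace ℝ (Fin d))}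
    (hB : MeasurableSet B) (h : sphMeasure d (A ∩ B) = 0) :
    wMass w (A ∪ B) = wMass w A + wMass w B :=
  setIntegral_union₀ h hB.nullMeasurableSet hwi.integrableOn hwi.integrableOn

/-- The polar angle, in `(-π, π]`, of the coordinates of `x` along `a` and `b`. -/
def planarAngle (a b x : EuclideanSpace ℝ (Fin d)) : ℝ :=
  Complex.arg ⟨⟪a, x⟫_ℝ, ⟪b, x⟫_ℝ⟩

theorem measurable_planarAngle (a b : EuclideanSpace ℝ (Fin d)) :
    Measurable (planarAngle a b) := by
  refine Complex.measurable_arg.comp (Continuous.measurable ?_)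
  have h : Continuous fun x : EuclideanSpace ℝ (Fin d) =>
      (⟪a, x⟫_ℝ : ℂ) + (⟪b, x⟫_ℝ : ℂ) * Complex.I := by fun_prop
  convert h using 2 with x
  exact Complex.mk_eq_add_mul_I _ _

theorem exists_polar (a b x : EuclideanSpace ℝ (Fin d)) :
    ∃ ρ : ℝ, 0 ≤ ρ ∧ ⟪a, x⟫_ℝ = ρ * Real.cos (planarAngle a b x) ∧
      ⟪b, x⟫_ℝ = ρ * Real.sin (planarAngle a b x) :=
  ⟨‖(⟨⟪a, x⟫_ℝ, ⟪b, x⟫_ℝ⟩ : ℂ)‖, norm_nonneg _,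
    (Complex.norm_mul_cos_arg ⟨⟪a, x⟫_ℝ, ⟪b, x⟫_ℝ⟩).symm,
    (Complex.norm_mul_sin_arg ⟨⟪a, x⟫_ℝ, ⟪b, x⟫_ℝ⟩).symm⟩

/-- The angular sector between two polar angles. -/
def sector (a b : EuclideanSpace ℝ (Fin d)) (α β : ℝ) : Set (EuclideanSpace ℝ (Fin d)) :=
  {x | α < planarAngle a b x ∧ planarAngle a b x ≤ β}

theorem pos_and_lt_pi_or_lt_neg_pi {x : ℝ} (hx : x ≤ 2 * π) (h : 0 < Real.sin x) :
    (0 < x ∧ x < π) ∨ x < -π := by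
  by_contra! hc
  rcases le_or_gt x 0 with h0 | h0
  · exact h.not_ge (Real.sin_nonpos_of_nonpos_of_neg_pi_le h0 hc.2)
  · have := Real.sin_nonpos_of_nonpos_of_neg_pi_le (x := x - 2 * π) (by linarith)
      (by linarith [hc.1 h0])
    rw [Real.sin_sub_two_pi] at this
    exact h.not_ge this

theorem mem_Ioo_of_sin_sub_pos {α β s : ℝ} (hα : -π ≤ α) (hβ : β ≤ π) (hαβ : α ≤ β)
    (hs : -π < s) (hs' : s ≤ π) (h1 : 0 < Real.sin (s - α)) (h2 : 0 < Real.sin (β - s)) :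
    s ∈ Ioo α β := by
  have h1' := pos_and_lt_pi_or_lt_neg_pi (by linarith) h1
  have h2' := pos_and_lt_pi_or_lt_neg_pi (by linarith) h2
  constructor <;> rcases h1' with h1' | h1' <;> rcases h2' with h2' | h2' <;>
    linarith [h1', h2', pi_pos]

theorem mem_sector_of_inner_pos {a b x : EuclideanSpace ℝ (Fin d)} {α β : ℝ} (hα : -π ≤ α)
    (hβ : β ≤ π) (hαβ : α ≤ β) (h1 : 0 < ⟪b, x⟫_ℝ * Real.cos α - ⟪a, x⟫_ℝ * Real.sin α)
    (h2 : 0 < ⟪a, x⟫_ℝ * Real.sin β - ⟪b, x⟫_ℝ * Real.cos β) : x ∈ sector a b α β := by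
  obtain ⟨ρ, hρ, ha, hb⟩ := exists_polar a b x
  have e1 : ⟪b, x⟫_ℝ * Real.cos α - ⟪a, x⟫_ℝ * Real.sin α =
      ρ * Real.sin (planarAngle a b x - α) := by
    rw [ha, hb, Real.sin_sub]; ring
  have e2 : ⟪a, x⟫_ℝ * Real.sin β - ⟪b, x⟫_ℝ * Real.cos β =
      ρ * Real.sin (β - planarAngle a b x) := by
    rw [ha, hb, Real.sin_sub]; ring
  have h := mem_Ioo_of_sin_sub_pos hα hβ hαβ (Complex.neg_pi_lt_arg _) (Complex.arg_le_pi _)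
    (pos_of_mul_pos_right (e1 ▸ h1) hρ) (pos_of_mul_pos_right (e2 ▸ h2) hρ)
  exact ⟨h.1, h.2.le⟩

/-- The polyhedral cone of points whose coordinates along `f k, f (k+1), …` are nonnegative. -/
def frameCone (f : Fin d → EuclideanSpace ℝ (Fin d)) (k : ℕ) :
    Set (EuclideanSpace ℝ (Fin d)) :=
  {x | ∀ j : Fin d, k ≤ (j : ℕ) → 0 ≤ ⟪f j, x⟫_ℝ}

theorem measurableSet_frameCone (f : Fin d → EuclideanSpace ℝ (Fin d)) (k : ℕ) :
    MeasurableSet (frameCone f k) := by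
  have : frameCone f k = ⋂ j : Fin d, ⋂ _ : k ≤ (j : ℕ), {x | 0 ≤ ⟪f j, x⟫_ℝ} := by
    ext; simp [frameCone]
  rw [this]
  exact MeasurableSet.iInter fun j => MeasurableSet.iInter fun _ =>
    (isClosed_le continuous_const (by fun_prop)).measurableSet

theorem measurableSet_sector (a b : EuclideanSpace ℝ (Fin d)) (α β : ℝ) :
    MeasurableSet (sector a b α β) :=
  (measurableSet_lt measurable_const (measurable_planarAngle a b)).inter
    (measurableSet_le (measurable_planarAngle a b) measurable_const)

/-- Rotation of an orthonormal frame by the angle `t` in the plane of `f i` and `f k`. -/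
def rotateFrame (f : Fin d → EuclideanSpace ℝ (Fin d)) (i k : Fin d) (t : ℝ) :
    Fin d → EuclideanSpace ℝ (Fin d) := fun j =>
  if j = k then Real.cos t • f i + Real.sin t • f k
  else if j = i then -Real.sin t • f i + Real.cos t • f k else f j

theorem Orthonormal.rotateFrame {f : Fin d → EuclideanSpace ℝ (Fin d)} (hf : Orthonormal ℝ f)
    {i k : Fin d} (hik : i ≠ k) (t : ℝ) : Orthonormal ℝ (rotateFrame f i k t) := by
  rw [orthonormal_iff_ite] at hf ⊢
  intro a b
  unfold _root_.rotateFrame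
  have hki := hik.symm
  split_ifs <;> subst_vars <;>
    simp only [inner_add_left, inner_add_right, real_inner_smul_left, real_inner_smul_right, hf,
      if_true] <;>
    simp_all [Ne.symm, eq_comm] <;> nlinarith [Real.sin_sq_add_cos_sq t]

theorem frameCone_rotateFrame (f : Fin d → EuclideanSpace ℝ (Fin d)) {i k : Fin d} (hik : i < k)
    (t : ℝ) : frameCone (rotateFrame f i k t) k =
      frameCone f (k + 1) ∩ {x | 0 ≤ ⟪Real.cos t • f i + Real.sin t • f k, x⟫_ℝ} := by
  ext x
  simp only [frameCone, mem_ofPred_eq, mem_inter_iff]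
  constructor
  · intro h
    refine ⟨fun j hj => ?_, by simpa [rotateFrame] using h k le_rfl⟩
    have h1 : j ≠ k := by rintro rfl; omega
    have h2 : j ≠ i := by rintro rfl; have := Fin.lt_def.1 hik; omega
    simpa [rotateFrame, h1, h2] using h j (by omega)
  · rintro ⟨h, hk⟩ j hj
    by_cases h1 : j = k
    · simpa [rotateFrame, h1] using hk
    · have h2 : j ≠ i := by rintro rfl; have := Fin.lt_def.1 hik; omega
      have h3 : (k : ℕ) ≠ j := fun h => h1 (Fin.ext h.symm)
      simpa [rotateFrame, h1, h2] using h j (by omega)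

/-- The vertices of the simplex cut out of the cone `frameCone f 2` by the angular sector from
`α` to `β` in the plane of `f 0` and `f 1`. -/
def sectorVertices {n : ℕ} (f : Fin (n + 2) → EuclideanSpace ℝ (Fin (n + 2))) (α β : ℝ) :
    Fin (n + 2) → EuclideanSpace ℝ (Fin (n + 2)) :=
  Matrix.vecCons (Real.cos α • f 0 + Real.sin α • f 1)
    (Matrix.vecCons (Real.cos β • f 0 + Real.sin β • f 1) fun i => f i.succ.succ)

section SectorVertices

variable {n : ℕ} {f : Fin (n + 2) → EuclideanSpace ℝ (Fin (n + 2))}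

theorem sum_smul_sectorVertices (α β : ℝ) (t : Fin (n + 2) → ℝ) :
    ∑ j, t j • sectorVertices f α β j =
      ∑ j, Matrix.vecCons (t 0 * Real.cos α + t 1 * Real.cos β)
        (Matrix.vecCons (t 0 * Real.sin α + t 1 * Real.sin β) fun i => t i.succ.succ) j • f j := by
  simp only [sectorVertices, Fin.sum_univ_succ, Matrix.cons_val_zero, Matrix.cons_val_succ,
    Fin.succ_zero_eq_one]
  module

theorem inner_sum_smul_sectorVertices (hf : Orthonormal ℝ f) (α β : ℝ) (t : Fin (n + 2) → ℝ)
    (j : Fin (n + 2)) : ⟪f j, ∑ j, t j • sectorVertices f α β j⟫_ℝ =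
      Matrix.vecCons (t 0 * Real.cos α + t 1 * Real.cos β)
        (Matrix.vecCons (t 0 * Real.sin α + t 1 * Real.sin β) fun i => t i.succ.succ) j := by
  rw [sum_smul_sectorVertices, hf.inner_right_fintype]

theorem inner_zero_sum_smul_sectorVertices (hf : Orthonormal ℝ f) (α β : ℝ)
    (t : Fin (n + 2) → ℝ) : ⟪f 0, ∑ j, t j • sectorVertices f α β j⟫_ℝ =
      t 0 * Real.cos α + t 1 * Real.cos β :=
  inner_sum_smul_sectorVertices hf α β t 0

theorem inner_one_sum_smul_sectorVertices (hf : Orthonormal ℝ f) (α β : ℝ)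
    (t : Fin (n + 2) → ℝ) : ⟪f 1, ∑ j, t j • sectorVertices f α β j⟫_ℝ =
      t 0 * Real.sin α + t 1 * Real.sin β :=
  inner_sum_smul_sectorVertices hf α β t 1

theorem inner_succ_sum_smul_sectorVertices (hf : Orthonormal ℝ f) (α β : ℝ)
    (t : Fin (n + 2) → ℝ) (i : Fin n) :
    ⟪f i.succ.succ, ∑ j, t j • sectorVertices f α β j⟫_ℝ = t i.succ.succ :=
  inner_sum_smul_sectorVertices hf α β t i.succ.succ

theorem linearIndependent_sectorVertices (hf : Orthonormal ℝ f) {α β : ℝ}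
    (h : 0 < Real.sin (β - α)) : LinearIndependent ℝ (sectorVertices f α β) := by
  rw [Fintype.linearIndependent_iff]
  intro t ht
  have h0 := inner_zero_sum_smul_sectorVertices hf α β t
  have h1 := inner_one_sum_smul_sectorVertices hf α β t
  have h2 := inner_succ_sum_smul_sectorVertices hf α β t
  simp only [ht, inner_zero_right] at h0 h1 h2
  rw [Real.sin_sub] at h
  refine Fin.cases ?_ (Fin.cases ?_ fun i => (h2 i).symm)
  · refine (mul_eq_zero.1 (?_ : t 0 * _ = 0)).resolve_right h.ne'
    linear_combination Real.cos β * h1 - Real.sin β * h0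
  · rw [Fin.succ_zero_eq_one]
    refine (mul_eq_zero.1 (?_ : t 1 * _ = 0)).resolve_right h.ne'
    linear_combination Real.sin α * h0 - Real.cos α * h1

theorem admissible_sectorVertices (hf : Orthonormal ℝ f) {α β : ℝ} (h1 : π / 6 ≤ β - α)
    (h2 : β - α ≤ π / 2) : Admissible (sectorVertices f α β) := by
  have hpi := pi_pos
  have hsin : 0 < Real.sin (β - α) := Real.sin_pos_of_pos_of_lt_pi (by linarith) (by linarith)
  have hff := orthonormal_iff_ite.1 hf
  have e01 : ⟪f 0, f 1⟫_ℝ = 0 := by simpa using hff 0 1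
  have e10 : ⟪f 1, f 0⟫_ℝ = 0 := by simpa using hff 1 0
  have e00 : ⟪f 0, f 0⟫_ℝ = 1 := by simpa using hff 0 0
  have e11 : ⟪f 1, f 1⟫_ℝ = 1 := by simpa using hff 1 1
  have e0 : ∀ i : Fin n, ⟪f 0, f i.succ.succ⟫_ℝ = 0 := fun i => by
    simpa [Fin.ext_iff] using hff 0 i.succ.succ
  have e1 : ∀ i : Fin n, ⟪f 1, f i.succ.succ⟫_ℝ = 0 := fun i => by
    simpa [Fin.ext_iff] using hff 1 i.succ.succ
  have hcirc : ∀ a b : ℝ, ⟪Real.cos a • f 0 + Real.sin a • f 1,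
      Real.cos b • f 0 + Real.sin b • f 1⟫_ℝ = Real.cos (b - a) := fun a b => by
    simp only [inner_add_left, inner_add_right, real_inner_smul_left, real_inner_smul_right,
      e00, e01, e10, e11, Real.cos_sub]
    ring
  have hplane : ∀ (a : ℝ) (i : Fin n),
      ⟪Real.cos a • f 0 + Real.sin a • f 1, f i.succ.succ⟫_ℝ = 0 := fun a i => by
    simp [inner_add_left, real_inner_smul_left, e0, e1]
  have hunit : ∀ a, Real.cos a • f 0 + Real.sin a • f 1 ∈ unitSphere (n + 2) := fun a => by
    rw [unitSphere, mem_sphere_zero_iff_norm, ← sq_eq_sq₀ (norm_nonneg _) zero_le_one,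
      ← real_inner_self_eq_norm_sq, hcirc]
    simp
  refine ⟨linearIndependent_sectorVertices hf hsin, ?_, ?_, ?_, ?_⟩
  · refine Fin.cases (hunit α) (Fin.cases (hunit β) fun i => ?_)
    simpa [unitSphere, sectorVertices] using hf.1 i.succ.succ
  · refine Fin.cases (by simp) (Fin.cases ?_ fun i => ?_) <;>
      refine Fin.cases (by simp) (Fin.cases ?_ fun j => ?_)
    · simp
    · intro _ _ _
      exact hplane β j
    · intro _ _ _
      rw [real_inner_comm]
      exact hplane β i
    · intro _ _ hij
      exact hf.2 fun h => hij h
  · intro i j hi hj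
    obtain rfl : i = 0 := Fin.ext hi
    obtain rfl : j = 1 := Fin.ext hj
    change Real.arccos ⟪Real.cos α • f 0 + Real.sin α • f 1,
      Real.cos β • f 0 + Real.sin β • f 1⟫_ℝ ∈ _
    rw [hcirc, Real.arccos_cos (by linarith) (by linarith)]
    exact ⟨h1, h2⟩
  · intro i j hi
    obtain rfl : i = 0 := Fin.ext hi
    refine Fin.cases (by simp) (Fin.cases (by simp) fun k _ => ?_) j
    exact hplane α k

theorem geodSimplex_subset_unitSphere {T : Fin d → EuclideanSpace ℝ (Fin d)}
    (hT : LinearIndependent ℝ T) : geodSimplex T ⊆ unitSphere d := by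
  rintro z ⟨t, _, hs, rfl⟩
  have hne : ∑ j, t j • T j ≠ 0 := fun h0 => by
    simp [Fintype.linearIndependent_iff.1 hT t h0] at hs
  rw [unitSphere, mem_sphere_zero_iff_norm, norm_smul, norm_inv, norm_norm]
  exact inv_mul_cancel₀ (norm_ne_zero_iff.2 hne)

theorem mem_geodSimplex_of_sum {T : Fin d → EuclideanSpace ℝ (Fin d)} {τ : Fin d → ℝ}
    (hτ : ∀ j, 0 ≤ τ j) (hx : ∑ j, τ j • T j ∈ unitSphere d) :
    ∑ j, τ j • T j ∈ geodSimplex T := by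
  have hx1 : ‖∑ j, τ j • T j‖ = 1 := by simpa [unitSphere] using hx
  have hs : 0 < ∑ j, τ j := by
    refine lt_of_le_of_ne (Finset.sum_nonneg fun j _ => hτ j) fun h => ?_
    have h0 := (Finset.sum_eq_zero_iff_of_nonneg fun j _ => hτ j).1 h.symm
    simp [fun j => h0 j (Finset.mem_univ j)] at hx1
  refine ⟨fun j => (∑ i, τ i)⁻¹ * τ j, fun j => mul_nonneg (inv_nonneg.2 hs.le) (hτ j), ?_, ?_⟩
  · rw [← Finset.mul_sum, inv_mul_cancel₀ hs.ne']
  · simp only [mul_smul, ← Finset.smul_sum]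
    rw [norm_smul, hx1, mul_one, norm_inv, inv_inv, Real.norm_of_nonneg hs.le, smul_smul,
      mul_inv_cancel₀ hs.ne', one_smul]

theorem Orthonormal.eq_of_inner_eq {g : Fin d → EuclideanSpace ℝ (Fin d)}
    (hg : Orthonormal ℝ g) {x y : EuclideanSpace ℝ (Fin d)}
    (h : ∀ j, ⟪g j, x⟫_ℝ = ⟪g j, y⟫_ℝ) : x = y := by
  obtain ⟨b, hb⟩ := Orthonormal.exists_orthonormalBasis_extension_of_card_eq (𝕜 := ℝ) (v := g)
    (s := univ) (by simp) (hg.comp _ Subtype.val_injective)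
  rw [← b.sum_repr' x, ← b.sum_repr' y]
  exact Finset.sum_congr rfl fun j _ => by rw [hb j (mem_univ j), h]

theorem subset_geodSimplex_sectorVertices (hf : Orthonormal ℝ f) {α β : ℝ} (h1 : α < β)
    (h2 : β - α ≤ π / 2) : frameCone f 2 ∩ sector (f 0) (f 1) α β ∩ unitSphere (n + 2) ⊆
      geodSimplex (sectorVertices f α β) := by
  rintro x ⟨⟨hC, hs1, hs2⟩, hx⟩
  have hpi := pi_pos
  obtain ⟨ρ, hρ, hx0, hx1⟩ := exists_polar (f 0) (f 1) x
  set s := planarAngle (f 0) (f 1) x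
  have hsin : 0 < Real.sin (β - α) := Real.sin_pos_of_pos_of_lt_pi (by linarith) (by linarith)
  set τ : Fin (n + 2) → ℝ := Matrix.vecCons (ρ * Real.sin (β - s) / Real.sin (β - α))
    (Matrix.vecCons (ρ * Real.sin (s - α) / Real.sin (β - α)) fun i => ⟪f i.succ.succ, x⟫_ℝ)
    with hτ
  have hsum : ∑ j, τ j • sectorVertices f α β j = x := by
    refine hf.eq_of_inner_eq (Fin.cases ?_ (Fin.cases ?_ fun i => ?_))
    · rw [inner_zero_sum_smul_sectorVertices hf, hx0]
      simp only [hτ, Matrix.cons_val_zero, Matrix.cons_val_one]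
      field_simp
      simp only [Real.sin_sub]
      ring
    · rw [Fin.succ_zero_eq_one, inner_one_sum_smul_sectorVertices hf, hx1]
      simp only [hτ, Matrix.cons_val_zero, Matrix.cons_val_one]
      field_simp
      simp only [Real.sin_sub]
      ring
    · rw [inner_succ_sum_smul_sectorVertices hf]
      simp [hτ]
  have hτ0 : ∀ j, 0 ≤ τ j := by
    refine Fin.cases ?_ (Fin.cases ?_ fun i => ?_)
    · exact div_nonneg (mul_nonneg hρ
        (Real.sin_nonneg_of_nonneg_of_le_pi (by linarith) (by linarith))) hsin.le
    · exact div_nonneg (mul_nonneg hρ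
        (Real.sin_nonneg_of_nonneg_of_le_pi (by linarith) (by linarith))) hsin.le
    · exact hC i.succ.succ (by simp)
  rw [← hsum] at hx ⊢
  exact mem_geodSimplex_of_sum hτ0 hx

theorem Orthonormal.cos_sin_ne_zero {g : Fin d → EuclideanSpace ℝ (Fin d)}
    (hg : Orthonormal ℝ g) {i k : Fin d} (hik : i ≠ k) (t : ℝ) :
    Real.cos t • g i + Real.sin t • g k ≠ 0 := by
  have := (hg.rotateFrame hik t).ne_zero k
  simpa [_root_.rotateFrame] using this

theorem geodSimplex_sectorVertices_ae_le (hf : Orthonormal ℝ f) {α β : ℝ} (hα : -π ≤ α)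
    (hβ : β ≤ π) (h1 : α < β) (h2 : β - α ≤ π / 2) :
    sphMeasure (n + 2) (geodSimplex (sectorVertices f α β) \
      (frameCone f 2 ∩ sector (f 0) (f 1) α β)) = 0 := by
  have hpi := pi_pos
  have hsin : 0 < Real.sin (β - α) := Real.sin_pos_of_pos_of_lt_pi (by linarith) (by linarith)
  have hnull : ∀ a : ℝ, sphMeasure (n + 2)
      {x | ⟪Real.cos (a + π / 2) • f 0 + Real.sin (a + π / 2) • f 1, x⟫_ℝ = 0} = 0 := fun a =>
    sphMeasure_hyperplane (hf.cos_sin_ne_zero (by simp) _)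
  refine measure_mono_null ?_ (measure_union_null (hnull α) (hnull β))
  rintro _ ⟨⟨t, ht, hs, rfl⟩, hnot⟩
  simp only [mem_union, mem_ofPred_eq, Real.cos_add_pi_div_two, Real.sin_add_pi_div_two,
    inner_add_left, real_inner_smul_left]
  by_contra! hne
  refine hnot ⟨?_, ?_⟩
  · refine Fin.cases (by simp) (Fin.cases (by simp) fun i _ => ?_)
    rw [real_inner_smul_right, inner_succ_sum_smul_sectorVertices hf]
    exact mul_nonneg (by positivity) (ht _)
  · have ha : ∀ c : ℝ, c * (t 0 * Real.sin α + t 1 * Real.sin β) * Real.cos α -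
        c * (t 0 * Real.cos α + t 1 * Real.cos β) * Real.sin α =
          c * t 1 * Real.sin (β - α) := fun c => by
      rw [Real.sin_sub]; ring
    have hb : ∀ c : ℝ, c * (t 0 * Real.cos α + t 1 * Real.cos β) * Real.sin β -
        c * (t 0 * Real.sin α + t 1 * Real.sin β) * Real.cos β =
          c * t 0 * Real.sin (β - α) := fun c => by
      rw [Real.sin_sub]; ring
    obtain ⟨hne1, hne2⟩ := hne
    simp only [real_inner_smul_right, inner_zero_sum_smul_sectorVertices hf,
      inner_one_sum_smul_sectorVertices hf] at hne1 hne2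
    refine mem_sector_of_inner_pos hα hβ h1.le ?_ ?_ <;>
      simp only [real_inner_smul_right, inner_zero_sum_smul_sectorVertices hf,
        inner_one_sum_smul_sectorVertices hf]
    · rw [ha]
      refine lt_of_le_of_ne (mul_nonneg (mul_nonneg (by positivity) (ht 1)) hsin.le) fun h => ?_
      rw [← ha] at h
      exact hne1 (by linear_combination -h)
    · rw [hb]
      refine lt_of_le_of_ne (mul_nonneg (mul_nonneg (by positivity) (ht 0)) hsin.le) fun h => ?_
      rw [← hb] at h
      exact hne2 (by linear_combination h)

theorem wMass_geodSimplex_sectorVertices (w : EuclideanSpace ℝ (Fin (n + 2)) → ℝ)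
    (hf : Orthonormal ℝ f) {α β : ℝ} (hα : -π ≤ α) (hβ : β ≤ π) (h1 : α < β)
    (h2 : β - α ≤ π / 2) : wMass w (geodSimplex (sectorVertices f α β)) =
      wMass w (frameCone f 2 ∩ sector (f 0) (f 1) α β) := by
  refine setIntegral_congr_set (Filter.EventuallyLE.antisymm ?_ ?_)
  · exact ae_le_set.2 (geodSimplex_sectorVertices_ae_le hf hα hβ h1 h2)
  · have hS : MeasurableSet (unitSphere (n + 2)) := Metric.isClosed_sphere.measurableSet
    rw [ae_le_set, sphMeasure, Measure.restrict_apply' hS]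
    refine measure_mono_null (fun x hx => ?_) measure_empty
    exact hx.1.2 (subset_geodSimplex_sectorVertices hf h1 h2 ⟨hx.1.1, hx.2⟩)

theorem exists_cap_subset_sector (hf : Orthonormal ℝ f) {α : ℝ} (hα : -π ≤ α)
    (hβ : α + π / 6 ≤ π) : ∃ x ∈ unitSphere (n + 2), cap x (((10 : ℝ) ^ (n + 2))⁻¹) ⊆
      frameCone f 2 ∩ sector (f 0) (f 1) α (α + π / 6) := by
  have hpi := pi_pos
  set κ : ℝ := (√(n + 1))⁻¹ with hκ
  set r : ℝ := ((10 : ℝ) ^ (n + 2))⁻¹ with hr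
  set m : ℝ := α + π / 12 with hm
  have hn : (0 : ℝ) < n + 1 := by positivity
  have hκ0 : 0 < κ := inv_pos.2 (Real.sqrt_pos.2 hn)
  have hκ2 : κ ^ 2 * (n + 1) = 1 := by
    rw [hκ, inv_pow, Real.sq_sqrt hn.le, inv_mul_cancel₀ hn.ne']
  have hsin : 1 / 6 ≤ Real.sin (π / 12) := by
    have := Real.mul_le_sin (x := π / 12) (by linarith) (by linarith)
    refine le_trans (le_of_eq ?_) this
    field_simp; norm_num
  have hrκ : r < κ * (1 / 6) := by
    have h1 : (n : ℝ) + 1 < 2 ^ (n + 1) := by exact_mod_cast Nat.lt_two_pow_self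
    have h2 : (2 : ℝ) ^ (n + 1) ≤ 10 ^ (n + 1) := pow_le_pow_left₀ (by norm_num) (by norm_num) _
    have h3 : √((n : ℝ) + 1) ≤ n + 1 := by
      rw [Real.sqrt_le_left hn.le]
      nlinarith [(Nat.cast_nonneg n : (0 : ℝ) ≤ n)]
    rw [hr, hκ, ← one_div, ← one_div, div_mul_div_comm, one_mul]
    refine one_div_lt_one_div_of_lt (mul_pos (Real.sqrt_pos.2 hn) (by norm_num)) ?_
    rw [pow_succ]
    linarith
  have hrκ' : r < κ * Real.sin (π / 12) :=
    hrκ.trans_le (mul_le_mul_of_nonneg_left hsin hκ0.le)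
  set c : Fin (n + 2) → ℝ := fun j =>
    κ * Matrix.vecCons (Real.cos m) (Matrix.vecCons (Real.sin m) fun _ : Fin n => 1) j with hc
  have hx : ∑ j, c j • f j ∈ unitSphere (n + 2) := by
    rw [unitSphere, mem_sphere_zero_iff_norm, ← sq_eq_sq₀ (norm_nonneg _) zero_le_one,
      ← real_inner_self_eq_norm_sq, hf.inner_sum]
    simp only [hc, Fin.sum_univ_succ, Matrix.cons_val_zero, Matrix.cons_val_succ, conj_trivial,
      Finset.sum_const, Finset.card_univ, Fintype.card_fin, nsmul_eq_mul]
    linear_combination hκ2 + κ ^ 2 * Real.sin_sq_add_cos_sq m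
  refine ⟨_, hx, fun y hy => ?_⟩
  have hdist : ‖∑ j, c j • f j - y‖ ≤ r := (norm_sub_le_gdist hx hy.1).trans hy.2
  have key : ∀ v : EuclideanSpace ℝ (Fin (n + 2)), ‖v‖ = 1 →
      r < ⟪v, ∑ j, c j • f j⟫_ℝ → 0 < ⟪v, y⟫_ℝ := fun v hv h => by
    have h1 := real_inner_le_norm v (∑ j, c j • f j - y)
    rw [hv, one_mul, inner_sub_right] at h1
    linarith
  have h0 : ⟪f 0, ∑ j, c j • f j⟫_ℝ = κ * Real.cos m := by
    rw [hf.inner_right_fintype]; rfl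
  have h1 : ⟪f 1, ∑ j, c j • f j⟫_ℝ = κ * Real.sin m := by
    rw [hf.inner_right_fintype]; rfl
  have hnorm : ∀ a, ‖Real.cos a • f 0 + Real.sin a • f 1‖ = 1 := fun a => by
    simpa [rotateFrame] using (hf.rotateFrame (i := 0) (k := 1) (by simp) a).1 1
  refine ⟨?_, mem_sector_of_inner_pos hα hβ (by linarith) ?_ ?_⟩
  · refine Fin.cases (by simp) (Fin.cases (by simp) fun i _ => (key _ (hf.1 _) ?_).le)
    rw [hf.inner_right_fintype]
    change r < κ * 1
    linarith
  · have h := key _ (hnorm (α + π / 2)) (by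
      rw [inner_add_left, real_inner_smul_left, real_inner_smul_left, h0, h1,
        Real.cos_add_pi_div_two, Real.sin_add_pi_div_two]
      refine hrκ'.trans_le (le_of_eq ?_)
      rw [show π / 12 = m - α by rw [hm]; ring, Real.sin_sub]; ring)
    rw [inner_add_left, real_inner_smul_left, real_inner_smul_left,
        Real.cos_add_pi_div_two, Real.sin_add_pi_div_two] at h
    linarith
  · have h := key _ (hnorm (α + π / 6 - π / 2)) (by
      rw [inner_add_left, real_inner_smul_left, real_inner_smul_left, h0, h1,
        Real.cos_sub_pi_div_two, Real.sin_sub_pi_div_two]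
      refine hrκ'.trans_le (le_of_eq ?_)
      rw [show π / 12 = (α + π / 6) - m by rw [hm]; ring, Real.sin_sub]; ring)
    rw [inner_add_left, real_inner_smul_left, real_inner_smul_left,
        Real.cos_sub_pi_div_two, Real.sin_sub_pi_div_two] at h
    linarith

end SectorVertices

/-- The part of the sphere in `A` is covered by finitely many admissible geodesic simplexes which,
up to null sets, lie in `A` and do not overlap, and whose weights are positive integer multiples
of `1 / N`. -/
def HasAdmissiblePartition (w : EuclideanSpace ℝ (Fin d) → ℝ) (N : ℕ)
    (A : Set (EuclideanSpace ℝ (Fin d))) : Prop :=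
  ∃ (ι : Type) (_ : Fintype ι) (T : ι → Fin d → EuclideanSpace ℝ (Fin d)),
    (∀ j, Admissible (T j)) ∧
    A ∩ unitSphere d ⊆ ⋃ j, geodSimplex (T j) ∧
    (∀ j, sphMeasure d (geodSimplex (T j) \ A) = 0) ∧
    (∀ i j, i ≠ j → sphMeasure d (geodSimplex (T i) ∩ geodSimplex (T j)) = 0) ∧
    ∀ j, ∃ k : ℕ, 0 < k ∧ (N : ℝ) * wMass w (geodSimplex (T j)) = (k : ℝ)

namespace HasAdmissiblePartition

variable {w : EuclideanSpace ℝ (Fin d) → ℝ} {N : ℕ}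

theorem empty : HasAdmissiblePartition w N ∅ :=
  ⟨Empty, inferInstance, Empty.elim, fun j => j.elim, by simp, fun j => j.elim, fun j => j.elim,
    fun j => j.elim⟩

theorem union {A B : Set (EuclideanSpace ℝ (Fin d))} (hA : HasAdmissiblePartition w N A)
    (hB : HasAdmissiblePartition w N B) (h : sphMeasure d (A ∩ B) = 0) :
    HasAdmissiblePartition w N (A ∪ B) := by
  obtain ⟨ι, _, T, hT, hAT, hTA, hTd, hTk⟩ := hA
  obtain ⟨κ, _, S, hS, hBS, hSB, hSd, hSk⟩ := hB
  have hcross : ∀ i j, sphMeasure d (geodSimplex (T i) ∩ geodSimplex (S j)) = 0 := fun i j => by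
    refine measure_mono_null ?_ (measure_union_null (measure_union_null (hTA i) (hSB j)) h)
    rintro x ⟨h1, h2⟩
    by_cases hxA : x ∈ A
    · by_cases hxB : x ∈ B
      · exact Or.inr ⟨hxA, hxB⟩
      · exact Or.inl (Or.inr ⟨h2, hxB⟩)
    · exact Or.inl (Or.inl ⟨h1, hxA⟩)
  refine ⟨ι ⊕ κ, inferInstance, Sum.elim T S, Sum.rec hT hS, ?_, ?_, ?_, Sum.rec hTk hSk⟩
  · rintro x ⟨hx | hx, hxs⟩
    · obtain ⟨j, hj⟩ := mem_iUnion.1 (hAT ⟨hx, hxs⟩)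
      exact mem_iUnion.2 ⟨Sum.inl j, hj⟩
    · obtain ⟨j, hj⟩ := mem_iUnion.1 (hBS ⟨hx, hxs⟩)
      exact mem_iUnion.2 ⟨Sum.inr j, hj⟩
  · rintro (j | j)
    · exact measure_mono_null (sdiff_subset_sdiff_right subset_union_left) (hTA j)
    · exact measure_mono_null (sdiff_subset_sdiff_right subset_union_right) (hSB j)
  · rintro (i | i) (j | j) hij
    · exact hTd i j fun h => hij (by rw [h])
    · exact hcross i j
    · rw [inter_comm]
      exact hcross j i
    · exact hSd i j fun h => hij (by rw [h])

end HasAdmissiblePartition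

section FrameConePartition

variable {n : ℕ} {w : EuclideanSpace ℝ (Fin (n + 2)) → ℝ} {N : ℕ}
  {f : Fin (n + 2) → EuclideanSpace ℝ (Fin (n + 2))}

theorem one_le_mul_wMass_sector (hw0 : ∀ x, 0 ≤ w x) (hwi : Integrable w (sphMeasure (n + 2)))
    (hbig : ∀ x ∈ unitSphere (n + 2),
      1 ≤ (N : ℝ) * wMass w (cap x (((10 : ℝ) ^ (n + 2))⁻¹)))
    (hf : Orthonormal ℝ f) {α β : ℝ} (hα : -π ≤ α) (hβ : β ≤ π) (h : π / 6 ≤ β - α) :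
    1 ≤ (N : ℝ) * wMass w (frameCone f 2 ∩ sector (f 0) (f 1) α β) := by
  obtain ⟨x, hx, hcap⟩ := exists_cap_subset_sector hf hα (by linarith)
  refine (hbig x hx).trans (mul_le_mul_of_nonneg_left (wMass_mono hw0 hwi ?_) N.cast_nonneg)
  intro y hy
  obtain ⟨h1, h2, h3⟩ := hcap hy
  exact ⟨h1, h2, by linarith⟩

theorem frameCone_inter_angle_union_sector {α β : ℝ} (h : α ≤ β) :
    frameCone f 2 ∩ {x | 0 ≤ α - planarAngle (f 0) (f 1) x} ∪
      frameCone f 2 ∩ sector (f 0) (f 1) α β =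
        frameCone f 2 ∩ {x | 0 ≤ β - planarAngle (f 0) (f 1) x} := by
  ext x
  simp only [sector, mem_union, mem_inter_iff, mem_ofPred_eq, sub_nonneg]
  constructor
  · rintro (⟨h1, h2⟩ | ⟨h1, _, h2⟩)
    · exact ⟨h1, h2.trans h⟩
    · exact ⟨h1, h2⟩
  · rintro ⟨h1, h2⟩
    rcases le_or_gt (planarAngle (f 0) (f 1) x) α with h3 | h3
    · exact Or.inl ⟨h1, h3⟩
    · exact Or.inr ⟨h1, h3, h2⟩

theorem frameCone_inter_angle_inter_sector {α β : ℝ} :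
    (frameCone f 2 ∩ {x | 0 ≤ α - planarAngle (f 0) (f 1) x}) ∩
      (frameCone f 2 ∩ sector (f 0) (f 1) α β) = ∅ := by
  rw [eq_empty_iff_forall_notMem]
  rintro x ⟨⟨_, h1⟩, _, h2, _⟩
  exact h2.not_ge (sub_nonneg.1 h1)

theorem wMass_angle_add_wMass_sector (hwi : Integrable w (sphMeasure (n + 2))) {α β : ℝ}
    (h : α ≤ β) : wMass w (frameCone f 2 ∩ {x | 0 ≤ α - planarAngle (f 0) (f 1) x}) +
      wMass w (frameCone f 2 ∩ sector (f 0) (f 1) α β) =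
        wMass w (frameCone f 2 ∩ {x | 0 ≤ β - planarAngle (f 0) (f 1) x}) := by
  rw [← frameCone_inter_angle_union_sector h, wMass_union_of_null hwi
    ((measurableSet_frameCone f 2).inter (measurableSet_sector _ _ _ _))]
  rw [frameCone_inter_angle_inter_sector, measure_empty]

theorem continuous_wMass_angle (hwi : Integrable w (sphMeasure (n + 2))) (hf : Orthonormal ℝ f) :
    Continuous fun β =>
      wMass w (frameCone f 2 ∩ {x | 0 ≤ β - planarAngle (f 0) (f 1) x}) := by
  refine continuous_iff_continuousAt.2 fun β =>
    continuousAt_wMass_inter_nonneg (h := fun β x => β - planarAngle (f 0) (f 1) x) hwi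
      (measurableSet_frameCone f 2) (fun t => measurable_const.sub (measurable_planarAngle _ _))
      (fun x => by fun_prop) β ?_
  refine measure_mono_null ?_ (sphMeasure_hyperplane
    (hf.cos_sin_ne_zero (i := 0) (k := 1) (by simp) (β + π / 2)))
  intro x hx
  obtain ⟨ρ, _, h0, h1⟩ := exists_polar (f 0) (f 1) x
  have hx' : planarAngle (f 0) (f 1) x = β := (sub_eq_zero.1 hx).symm
  rw [hx'] at h0 h1
  change ⟪_, _⟫_ℝ = _
  rw [inner_add_left, real_inner_smul_left, real_inner_smul_left, h0, h1,
    Real.cos_add_pi_div_two, Real.sin_add_pi_div_two]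
  ring

theorem HasAdmissiblePartition.extend_angle (hw0 : ∀ x, 0 ≤ w x)
    (hwi : Integrable w (sphMeasure (n + 2)))
    (hbig : ∀ x ∈ unitSphere (n + 2),
      1 ≤ (N : ℝ) * wMass w (cap x (((10 : ℝ) ^ (n + 2))⁻¹)))
    (hf : Orthonormal ℝ f) {α β : ℝ} (hα : -π ≤ α) (hβ : β ≤ π) (h1 : π / 6 ≤ β - α)
    (h2 : β - α ≤ π / 2) {p q : ℕ}
    (hp : N * wMass w (frameCone f 2 ∩ {x | 0 ≤ α - planarAngle (f 0) (f 1) x}) = p)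
    (hq : N * wMass w (frameCone f 2 ∩ {x | 0 ≤ β - planarAngle (f 0) (f 1) x}) = q)
    (h : HasAdmissiblePartition w N
      (frameCone f 2 ∩ {x | 0 ≤ α - planarAngle (f 0) (f 1) x})) :
    HasAdmissiblePartition w N
      (frameCone f 2 ∩ {x | 0 ≤ β - planarAngle (f 0) (f 1) x}) := by
  have hpi := pi_pos
  have hαβ : α < β := by linarith
  have hbound := one_le_mul_wMass_sector hw0 hwi hbig hf hα hβ h1
  have hsub : N * wMass w (frameCone f 2 ∩ sector (f 0) (f 1) α β) = (q : ℝ) - p := by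
    rw [← hp, ← hq, ← wMass_angle_add_wMass_sector hwi hαβ.le]
    ring
  have hpq : p < q := by
    rw [hsub] at hbound
    exact_mod_cast (by linarith : (p : ℝ) < q)
  rw [← frameCone_inter_angle_union_sector hαβ.le]
  refine h.union ?_ (by rw [frameCone_inter_angle_inter_sector, measure_empty])
  refine ⟨Unit, inferInstance, fun _ => sectorVertices f α β,
    fun _ => admissible_sectorVertices hf h1 h2, fun x hx => ?_,
    fun _ => geodSimplex_sectorVertices_ae_le hf hα hβ hαβ h2,
    fun i j hij => absurd (Subsingleton.elim i j) hij, fun _ => ⟨q - p, by omega, ?_⟩⟩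
  · exact mem_iUnion.2 ⟨(), subset_geodSimplex_sectorVertices hf hαβ h2 hx⟩
  · rw [wMass_geodSimplex_sectorVertices w hf hα hβ hαβ h2, hsub, Nat.cast_sub hpq.le]

theorem exists_angle_natCast (hw0 : ∀ x, 0 ≤ w x) (hwi : Integrable w (sphMeasure (n + 2)))
    (hbig : ∀ x ∈ unitSphere (n + 2),
      1 ≤ (N : ℝ) * wMass w (cap x (((10 : ℝ) ^ (n + 2))⁻¹)))
    (hf : Orthonormal ℝ f) {γ : ℝ} (hγ : -π ≤ γ) (hγ' : γ + π / 6 ≤ π) :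
    ∃ β ∈ Icc γ (γ + π / 6), ∃ q : ℕ,
      N * wMass w (frameCone f 2 ∩ {x | 0 ≤ β - planarAngle (f 0) (f 1) x}) = q := by
  have hpi := pi_pos
  have hbound := one_le_mul_wMass_sector hw0 hwi hbig hf hγ hγ' (by linarith)
  have hadd := wMass_angle_add_wMass_sector (w := w) (f := f) hwi
    (by linarith : γ ≤ γ + π / 6)
  set F : ℝ → ℝ := fun β =>
    N * wMass w (frameCone f 2 ∩ {x | 0 ≤ β - planarAngle (f 0) (f 1) x}) with hF
  have hF0 : 0 ≤ F γ := mul_nonneg N.cast_nonneg (integral_nonneg fun x => hw0 x)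
  have hF1 : F γ + 1 ≤ F (γ + π / 6) := by
    simp only [hF]
    rw [← hadd, mul_add]
    linarith
  have hcont : Continuous F := continuous_const.mul (continuous_wMass_angle hwi hf)
  obtain ⟨β, hβ, hβF⟩ := intermediate_value_Icc (by linarith : γ ≤ γ + π / 6)
    hcont.continuousOn (show (⌈F γ⌉₊ : ℝ) ∈ Icc (F γ) (F (γ + π / 6)) from
      ⟨Nat.le_ceil _, (Nat.ceil_lt_add_one hF0).le.trans hF1⟩)
  exact ⟨β, hβ, _, hβF⟩

theorem hasAdmissiblePartition_frameCone_two (hw0 : ∀ x, 0 ≤ w x)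
    (hwi : Integrable w (sphMeasure (n + 2)))
    (hbig : ∀ x ∈ unitSphere (n + 2),
      1 ≤ (N : ℝ) * wMass w (cap x (((10 : ℝ) ^ (n + 2))⁻¹)))
    (hf : Orthonormal ℝ f) {q : ℕ} (hq : N * wMass w (frameCone f 2) = q) :
    HasAdmissiblePartition w N (frameCone f 2) := by
  have hpi := pi_pos
  have hchain : ∀ k : ℕ, k ≤ 5 → ∃ β ∈ Icc (-π + k * (π / 3)) (-π + k * (π / 3) + π / 6),
      (∃ p : ℕ, N * wMass w
        (frameCone f 2 ∩ {x | 0 ≤ β - planarAngle (f 0) (f 1) x}) = p) ∧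
      HasAdmissiblePartition w N
        (frameCone f 2 ∩ {x | 0 ≤ β - planarAngle (f 0) (f 1) x}) := by
    intro k
    induction k with
    | zero =>
      intro _
      have h0 : frameCone f 2 ∩ {x | 0 ≤ -π - planarAngle (f 0) (f 1) x} = ∅ := by
        rw [eq_empty_iff_forall_notMem]
        rintro x ⟨_, hx⟩
        exact (Complex.neg_pi_lt_arg _).not_ge (sub_nonneg.1 hx)
      refine ⟨-π, ⟨by simp, by simp; linarith⟩, ?_⟩
      rw [h0]
      exact ⟨⟨0, by simp [wMass]⟩, .empty⟩
    | succ k ih =>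
      intro hk
      obtain ⟨α, hα, ⟨p, hp⟩, hpart⟩ := ih (by omega)
      have hk0 : (0 : ℝ) ≤ k * (π / 3) := by positivity
      have hk4 : k * (π / 3) ≤ 4 * (π / 3) :=
        mul_le_mul_of_nonneg_right (by exact_mod_cast (by omega : k ≤ 4)) (by positivity)
      have hk1 : ((k + 1 : ℕ) : ℝ) * (π / 3) = k * (π / 3) + π / 3 := by push_cast; ring
      rw [hk1]
      obtain ⟨β, hβ, r, hr⟩ := exists_angle_natCast (γ := -π + (k * (π / 3) + π / 3))
        hw0 hwi hbig hf (by linarith) (by linarith)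
      refine ⟨β, hβ, ⟨r, hr⟩, hpart.extend_angle hw0 hwi hbig hf ?_ ?_ ?_ ?_ hp hr⟩ <;>
        linarith [hα.1, hα.2, hβ.1, hβ.2]
  obtain ⟨α, hα, ⟨p, hp⟩, hpart⟩ := hchain 5 le_rfl
  have hall : frameCone f 2 ∩ {x | 0 ≤ π - planarAngle (f 0) (f 1) x} = frameCone f 2 :=
    inter_eq_left.2 fun x _ => sub_nonneg.2 (Complex.arg_le_pi _)
  push_cast at hα
  have := hpart.extend_angle (β := π) (q := q) hw0 hwi hbig hf (by linarith [hα.1]) le_rfl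
    (by linarith [hα.2]) (by linarith [hα.1]) hp (by rw [hall, hq])
  rwa [hall] at this

theorem hasAdmissiblePartition_frameCone (hw0 : ∀ x, 0 ≤ w x)
    (hwi : Integrable w (sphMeasure (n + 2)))
    (hbig : ∀ x ∈ unitSphere (n + 2),
      1 ≤ (N : ℝ) * wMass w (cap x (((10 : ℝ) ^ (n + 2))⁻¹)))
    {k : ℕ} (hk : k ≤ n) (hf : Orthonormal ℝ f) {q : ℕ}
    (hq : N * wMass w (frameCone f (k + 2)) = 2 ^ k * q) :
    HasAdmissiblePartition w N (frameCone f (k + 2)) := by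
  induction k generalizing f with
  | zero => exact hasAdmissiblePartition_frameCone_two hw0 hwi hbig hf (q := q) (by simpa using hq)
  | succ k ih =>
    set K : Fin (n + 2) := ⟨k + 2, by omega⟩ with hK
    have h0K : (0 : Fin (n + 2)) < K := by simp [Fin.lt_def, hK]
    set C := frameCone f (k + 1 + 2) with hC
    have hrot : ∀ t, frameCone (rotateFrame f 0 K t) (k + 2) =
        C ∩ {x | 0 ≤ ⟪Real.cos t • f 0 + Real.sin t • f K, x⟫_ℝ} :=
      frameCone_rotateFrame f h0K
    have hnull : ∀ t, sphMeasure (n + 2)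
        {x | ⟪Real.cos t • f 0 + Real.sin t • f K, x⟫_ℝ = 0} = 0 := fun t =>
      sphMeasure_hyperplane (hf.cos_sin_ne_zero h0K.ne t)
    have hneg : ∀ t x, ⟪Real.cos (t + π) • f 0 + Real.sin (t + π) • f K, x⟫_ℝ =
        -⟪Real.cos t • f 0 + Real.sin t • f K, x⟫_ℝ := fun t x => by
      rw [Real.cos_add_pi, Real.sin_add_pi, neg_smul, neg_smul, ← neg_add, inner_neg_left]
    have hunion : ∀ t, frameCone (rotateFrame f 0 K t) (k + 2) ∪
        frameCone (rotateFrame f 0 K (t + π)) (k + 2) = C := fun t => by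
      rw [hrot, hrot, ← inter_union_distrib_left, inter_eq_left]
      intro x _
      simp only [mem_union, mem_ofPred_eq, hneg, neg_nonneg]
      exact le_total _ _
    have hinter : ∀ t, sphMeasure (n + 2) (frameCone (rotateFrame f 0 K t) (k + 2) ∩
        frameCone (rotateFrame f 0 K (t + π)) (k + 2)) = 0 := fun t => by
      refine measure_mono_null ?_ (hnull t)
      rw [hrot, hrot]
      rintro x ⟨⟨_, h1⟩, _, h2⟩
      simp only [mem_ofPred_eq, hneg, neg_nonneg] at h1 h2
      exact le_antisymm h2 h1
    set g : ℝ → ℝ := fun t => wMass w (frameCone (rotateFrame f 0 K t) (k + 2)) with hg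
    have hadd : ∀ t, g t + g (t + π) = wMass w C := fun t => by
      rw [← hunion t, wMass_union_of_null hwi (measurableSet_frameCone _ _) (hinter t)]
    have hcont : Continuous g := by
      simp only [hg, hrot]
      exact continuous_iff_continuousAt.2 fun t => continuousAt_wMass_inter_nonneg
        (h := fun t x => ⟪Real.cos t • f 0 + Real.sin t • f K, x⟫_ℝ) hwi
        (measurableSet_frameCone _ _) (fun t => (by fun_prop : Continuous _).measurable)
        (fun x => by fun_prop) t (hnull t)
    obtain ⟨t, ht⟩ : ∃ t, g t = wMass w C / 2 := by
      have h := hadd 0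
      rw [zero_add] at h
      obtain ⟨t, _, ht⟩ := intermediate_value_uIcc (a := 0) (b := π) hcont.continuousOn
        (show wMass w C / 2 ∈ uIcc (g 0) (g π) by
          rw [mem_uIcc]
          rcases le_total (g 0) (g π) with h' | h'
          · left; constructor <;> linarith
          · right; constructor <;> linarith)
      exact ⟨t, ht⟩
    have hhalf : N * (wMass w C / 2) = 2 ^ k * q := by
      rw [pow_succ] at hq
      linarith
    have ht' : g (t + π) = wMass w C / 2 := by linarith [hadd t]
    rw [← hunion t]
    exact (ih (by omega) (hf.rotateFrame h0K.ne _) (by rw [← hhalf, ← ht])).union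
      (ih (by omega) (hf.rotateFrame h0K.ne _) (by rw [← hhalf, ← ht'])) (hinter t)

end FrameConePartition

theorem cap_subset_inter_of_mem_sphInterior {A B : Set (EuclideanSpace ℝ (Fin d))}
    {x : EuclideanSpace ℝ (Fin d)} (hx : x ∈ unitSphere d) (hA : x ∈ sphInterior A)
    (hB : x ∈ sphInterior B) : ∃ r : ℝ, 0 < r ∧ cap x r ⊆ A ∩ B := by
  obtain ⟨_, ε, hε, hεA⟩ := hA
  obtain ⟨_, δ, hδ, hδB⟩ := hB
  have hmin : 0 < min ε δ := lt_min hε hδ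
  refine ⟨min ε δ / 2, half_pos hmin, fun y hy => ?_⟩
  have hlt : dist y x < min ε δ := by
    rw [dist_comm, dist_eq_norm]
    exact ((norm_sub_le_gdist hx hy.1).trans hy.2).trans_lt (half_lt_self hmin)
  exact ⟨hεA ⟨hlt.trans_le (min_le_left _ _), hy.1⟩, hδB ⟨hlt.trans_le (min_le_right _ _), hy.1⟩⟩

/-- Partition of the sphere into admissible geodesic simplexes with
weights that are integer multiples of `1/N`. -/
theorem admissible_simplex_partition (d : ℕ) (hd : 3 ≤ d)
    (w : EuclideanSpace ℝ (Fin d) → ℝ)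
    (hw0 : ∀ x, 0 ≤ w x) (hwi : Integrable w (sphMeasure d))
    (hnorm : wMass w (unitSphere d) = 1)
    (hpos : ∀ x ∈ unitSphere d, ∀ r : ℝ, 0 < r → 0 < wMass w (cap x r))
    (N : ℕ) (hN : 0 < N) (hdvd : 2 ^ (d - 2) ∣ N)
    (hbig : ∀ x ∈ unitSphere d, 1 ≤ (N : ℝ) * wMass w (cap x (((10 : ℝ) ^ d)⁻¹))) :
    ∃ (m : ℕ) (T : Fin m → Fin d → EuclideanSpace ℝ (Fin d)),
      (∀ j, Admissible (T j)) ∧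
      (⋃ j, geodSimplex (T j)) = unitSphere d ∧
      (∀ i j, i ≠ j →
        sphInterior (geodSimplex (T i)) ∩ sphInterior (geodSimplex (T j)) = ∅) ∧
      ∀ j, ∃ k : ℕ, 0 < k ∧ (N : ℝ) * wMass w (geodSimplex (T j)) = (k : ℝ) := by
  obtain ⟨n, rfl⟩ : ∃ n, d = n + 2 := ⟨d - 2, by omega⟩
  obtain ⟨q, hq⟩ := hdvd
  have hf : Orthonormal ℝ (EuclideanSpace.basisFun (Fin (n + 2)) ℝ) :=
    (EuclideanSpace.basisFun (Fin (n + 2)) ℝ).orthonormal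
  have huniv : frameCone (EuclideanSpace.basisFun (Fin (n + 2)) ℝ) (n + 2) = univ :=
    eq_univ_of_forall fun x j hj => absurd j.isLt (not_lt.2 hj)
  have hmass : wMass w univ = 1 := by
    rw [← hnorm]
    simp only [wMass, sphMeasure, Measure.restrict_univ, Measure.restrict_restrict_of_subset
      subset_rfl]
  obtain ⟨ι, _, T, hT, hcover, -, hnull, hmul⟩ := hasAdmissiblePartition_frameCone hw0 hwi hbig
    le_rfl hf (q := q) (by rw [huniv, hmass, mul_one, hq]; push_cast; simp)
  rw [huniv, univ_inter] at hcover
  have hsub : ∀ j, geodSimplex (T j) ⊆ unitSphere (n + 2) := fun j =>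
    geodSimplex_subset_unitSphere (hT j).1
  let e := Fintype.equivFin ι
  refine ⟨Fintype.card ι, T ∘ e.symm, fun j => hT _, ?_, fun i j hij => ?_, fun j => hmul _⟩
  · refine (iUnion_subset fun j => hsub _).antisymm fun x hx => ?_
    obtain ⟨j, hj⟩ := mem_iUnion.1 (hcover hx)
    exact mem_iUnion.2 ⟨e j, by simpa using hj⟩
  · rw [eq_empty_iff_forall_notMem]
    rintro x ⟨hxi, hxj⟩
    have hx : x ∈ unitSphere (n + 2) := hsub _ hxi.1
    obtain ⟨r, hr, hcap⟩ := cap_subset_inter_of_mem_sphInterior hx hxi hxj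
    refine (hpos x hx r hr).ne' (setIntegral_measure_zero _ (measure_mono_null hcap ?_))
    exact hnull _ _ (e.symm.injective.ne hij)
end
end

section
/- For every integer d ≥ 1 and every constant c > 0 there exists a constant c' > 0, depending only on d and c, with the following property: if G ⊂ ℝ^d is a convex set of diameter 2r for some r > 0 whose d-dimensional Lebesgue measure is at least c · r^{d−1} · a for some a ∈ (0, r], then G contains a closed Euclidean ball of radius c' · a. -/
open MeasureTheory Set

/-- Cramer's rule, with determinants taken in an arbitrary basis. -/
theorem exists_sum_smul_eq_and_det_update_eq {ι K V : Type*} [Fintype ι] [DecidableEq ι] [Field K]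
    [AddCommGroup V] [Module K V] (e : Module.Basis ι K V) {w : ι → V} (hw : e.det w ≠ 0) (u : V) :
    ∃ t : ι → K, ∑ i, t i • w i = u ∧
      ∀ i, e.det (Function.update w i u) = t i * e.det w := by
  obtain ⟨hli, hsp⟩ := e.is_basis_iff_det.mpr (isUnit_iff_ne_zero.mpr hw)
  have hu : u ∈ Submodule.span K (range w) := hsp ▸ Submodule.mem_top
  obtain ⟨t, rfl⟩ := (Submodule.mem_span_range_iff_exists_fun K).mp hu
  refine ⟨t, rfl, fun i => ?_⟩
  rw [e.det.map_update_sum, Finset.sum_eq_single i]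
  · simp [e.det.map_update_smul]
  · intro j _ hj
    rw [e.det.map_update_smul, e.det.map_update_self w hj.symm, smul_zero]
  · simp

/-- Hadamard's inequality. -/
theorem OrthonormalBasis.abs_det_le_prod_norm {d : ℕ} {E : Type*} [NormedAddCommGroup E]
    [InnerProductSpace ℝ E] (b : OrthonormalBasis (Fin d) ℝ E) (v : Fin d → E) :
    |b.toBasis.det v| ≤ ∏ i, ‖v i‖ := by
  have : Fact (Module.finrank ℝ E = d) := ⟨by simp [Module.finrank_eq_card_basis b.toBasis]⟩
  let o : Orientation ℝ E (Fin d) := b.toBasis.orientation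
  rw [← o.volumeForm_robust' b]
  exact o.abs_volumeForm_apply_le v

/-- A set all of whose points have coordinates in `[-2, 2]` with respect to an origin `z` and
vectors `w` has volume at most `4 ^ d` times that of the parallelepiped spanned by `w`. -/
theorem OrthonormalBasis.volume_le_of_forall_abs_le_two {d : ℕ} {E : Type*}
    [NormedAddCommGroup E] [InnerProductSpace ℝ E] [FiniteDimensional ℝ E] [MeasurableSpace E]
    [BorelSpace E] (b : OrthonormalBasis (Fin d) ℝ E) (w : Fin d → E) (z : E) {G : Set E}
    (hG : ∀ x ∈ G, ∃ t : Fin d → ℝ, ∑ i, t i • w i = x - z ∧ ∀ i, |t i| ≤ 2) :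
    volume G ≤ ENNReal.ofReal (4 ^ d * |b.toBasis.det w|) := by
  have hsub : G ⊆ (fun x => (z - ∑ i, (2 : ℝ) • w i) + x) ''
      parallelepiped fun i => (4 : ℝ) • w i := by
    intro x hx
    obtain ⟨t, ht, htb⟩ := hG x hx
    refine ⟨_, (mem_parallelepiped_iff _ _).mpr ⟨fun i => (t i + 2) / 4, ⟨?_, ?_⟩, rfl⟩, ?_⟩
    · intro i
      have := abs_le.mp (htb i)
      simp only [Pi.zero_apply]
      linarith
    · intro i
      have := abs_le.mp (htb i)
      simp only [Pi.one_apply]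
      linarith
    · have : ∑ i, ((t i + 2) / 4) • (4 : ℝ) • w i = (x - z) + ∑ i, (2 : ℝ) • w i := by
        rw [← ht, ← Finset.sum_add_distrib]
        refine Finset.sum_congr rfl fun i _ => ?_
        rw [smul_smul, ← add_smul]
        congr 1
        ring
      simp only [this]
      abel
  calc volume G ≤ _ := measure_mono hsub
    _ = volume (parallelepiped fun i => (4 : ℝ) • w i) := by
      rw [image_add_left, measure_preimage_add]
    _ = _ := by
      rw [← b.addHaar_eq_volume, Measure.addHaar_parallelepiped,
        AlternatingMap.map_smul_univ]
      simp [abs_mul]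

/-- A convex set containing `z` and all `z + w i` contains every point whose coordinates relative
to this simplex are close enough to those of the centroid. -/
theorem Convex.add_sum_smul_mem_of_abs_le {d : ℕ} {E : Type*} [AddCommGroup E] [Module ℝ E]
    {G : Set E} (hG : Convex ℝ G) {z : E} {w : Fin d → E} (hz : z ∈ G) (hw : ∀ i, z + w i ∈ G)
    {t : Fin d → ℝ} (ht : ∀ i, |t i| ≤ 1 / ((d : ℝ) + 1) ^ 2) :
    z + ∑ i, (1 / ((d : ℝ) + 1) + t i) • w i ∈ G := by
  set s : Fin d → ℝ := fun i => 1 / ((d : ℝ) + 1) + t i with hs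
  have hd : (0 : ℝ) ≤ d := d.cast_nonneg
  have hsq : 1 / ((d : ℝ) + 1) ^ 2 ≤ 1 / (d + 1) :=
    one_div_le_one_div_of_le (by positivity) (by nlinarith)
  have hs0 : ∀ i, 0 ≤ s i := fun i => by
    have := abs_le.mp (ht i)
    simp only [hs]
    linarith
  have hs1 : ∑ i, s i ≤ 1 := by
    calc ∑ i, s i ≤ ∑ _i : Fin d, (1 / ((d : ℝ) + 1) + 1 / ((d : ℝ) + 1) ^ 2) :=
          Finset.sum_le_sum fun i _ => by
            have := abs_le.mp (ht i)
            simp only [hs]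
            linarith
      _ = d * (d + 2) / ((d : ℝ) + 1) ^ 2 := by
        rw [Finset.sum_const, Finset.card_univ, Fintype.card_fin, nsmul_eq_mul]
        field_simp
        ring
      _ ≤ 1 := by
        rw [div_le_one (by positivity)]
        nlinarith
  have hmem := hG.sum_mem (t := Finset.univ)
    (w := fun o : Option (Fin d) => o.elim (1 - ∑ i, s i) s)
    (z := fun o : Option (Fin d) => o.elim z fun i => z + w i)
    (by rintro (_ | i) - <;> simp [hs0, hs1]) (by simp [Fintype.sum_option])
    (by rintro (_ | i) - <;> simp [hz, hw])
  convert hmem using 1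
  simp only [Fintype.sum_option, Option.elim, smul_add, Finset.sum_add_distrib, ← Finset.sum_smul,
    sub_smul, one_smul]
  abel

/-- In a bounded set with nonempty interior one can find a simplex, with one vertex at a given
interior point `z`, whose volume is at least half of the largest possible. -/
theorem OrthonormalBasis.exists_forall_abs_det_le_two_mul {d : ℕ} {E : Type*}
    [NormedAddCommGroup E] [InnerProductSpace ℝ E] (b : OrthonormalBasis (Fin d) ℝ E) {G : Set E}
    (hG : Bornology.IsBounded G) {z : E} (hz : z ∈ interior G) :
    ∃ w : Fin d → E, (∀ i, z + w i ∈ G) ∧ 0 < |b.toBasis.det w| ∧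
      ∀ v : Fin d → E, (∀ i, z + v i ∈ G) → |b.toBasis.det v| ≤ 2 * |b.toBasis.det w| := by
  set S : Set ℝ := {x | ∃ v : Fin d → E, (∀ i, z + v i ∈ G) ∧ |b.toBasis.det v| = x}
  have hzG : z ∈ G := interior_subset hz
  have hbdd : BddAbove S := by
    refine ⟨∏ _i : Fin d, Metric.diam G, ?_⟩
    rintro _ ⟨v, hv, rfl⟩
    refine (b.abs_det_le_prod_norm v).trans
      (Finset.prod_le_prod (fun _ _ => norm_nonneg _) fun i _ => ?_)
    simpa using Metric.dist_le_diam_of_mem hG (hv i) hzG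
  obtain ⟨ε, hε, hball⟩ := Metric.isOpen_iff.mp isOpen_interior z hz
  have hpos : ∃ x ∈ S, 0 < x := by
    refine ⟨_, ⟨fun i => (ε / 2) • b i, fun i => interior_subset (hball ?_), rfl⟩, ?_⟩
    · simp [norm_smul, abs_of_pos hε, hε]
    · rw [AlternatingMap.map_smul_univ, ← b.coe_toBasis, b.toBasis.det_self]
      simp only [Finset.prod_const, smul_eq_mul, mul_one]
      positivity
  obtain ⟨x, hxS, hx⟩ := hpos
  have hsup : 0 < sSup S := hx.trans_le (le_csSup hbdd hxS)
  obtain ⟨_, ⟨w, hw, rfl⟩, hlt⟩ := exists_lt_of_lt_csSup ⟨x, hxS⟩ (half_lt_self hsup)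
  refine ⟨w, hw, (half_pos hsup).trans hlt, fun v hv => ?_⟩
  have := le_csSup hbdd ⟨v, hv, rfl⟩
  linarith

/-- A convex set of diameter `2r` and volume at least `c·r^{d-1}·a`
contains a Euclidean ball of radius `c'·a`. -/
theorem convex_set_contains_ball (d : ℕ) (hd : 1 ≤ d) (c : ℝ) (hc : 0 < c) :
    ∃ c' : ℝ, 0 < c' ∧
      ∀ (G : Set (EuclideanSpace ℝ (Fin d))) (r a : ℝ),
        Convex ℝ G → 0 < r → Metric.diam G = 2 * r → a ∈ Set.Ioc (0 : ℝ) r →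
        ENNReal.ofReal (c * r ^ (d - 1) * a) ≤ volume G →
        ∃ z : EuclideanSpace ℝ (Fin d), Metric.closedBall z (c' * a) ⊆ G := by
  refine ⟨c / (2 ^ (d - 1) * 4 ^ d * ((d : ℝ) + 1) ^ 2), by positivity, ?_⟩
  intro G r a hconv hr hdiam ha hvol
  have ha0 : 0 < a := ha.1
  have hb : Bornology.IsBounded G := by
    by_contra h
    rw [Metric.diam_eq_zero_of_unbounded h] at hdiam
    linarith
  obtain ⟨z, hz⟩ : (interior G).Nonempty := by
    by_contra h
    have h0 : volume G = 0 := measure_mono_null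
      (by simpa [frontier, not_nonempty_iff_eq_empty.mp h] using subset_closure)
      (hconv.addHaar_frontier volume)
    rw [h0, nonpos_iff_eq_zero, ENNReal.ofReal_eq_zero] at hvol
    have : 0 < c * r ^ (d - 1) * a := by positivity
    linarith
  have hzG : z ∈ G := interior_subset hz
  set b := EuclideanSpace.basisFun (Fin d) ℝ
  obtain ⟨w, hw, hpos, hmax⟩ := b.exists_forall_abs_det_le_two_mul hb hz
  have hne : b.toBasis.det w ≠ 0 := abs_pos.mp hpos
  have hdet : c * r ^ (d - 1) * a ≤ 4 ^ d * |b.toBasis.det w| := by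
    refine (ENNReal.ofReal_le_ofReal_iff (by positivity)).mp
      (hvol.trans (b.volume_le_of_forall_abs_le_two w z fun x hx => ?_))
    obtain ⟨t, ht, htdet⟩ := exists_sum_smul_eq_and_det_update_eq b.toBasis hne (x - z)
    refine ⟨t, ht, fun i => le_of_mul_le_mul_right ?_ hpos⟩
    rw [← abs_mul, ← htdet]
    refine hmax _ fun j => ?_
    rcases eq_or_ne j i with rfl | hj
    · simpa using hx
    · simpa [hj] using hw j
  refine ⟨z + ∑ i, (1 / ((d : ℝ) + 1)) • w i, fun y hy => ?_⟩
  obtain ⟨t, ht, htdet⟩ := exists_sum_smul_eq_and_det_update_eq b.toBasis hne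
    (y - (z + ∑ i, (1 / ((d : ℝ) + 1)) • w i))
  have hy' : y = z + ∑ i, (1 / ((d : ℝ) + 1) + t i) • w i := by
    simp only [add_smul, Finset.sum_add_distrib, ht]
    abel
  rw [hy']
  refine hconv.add_sum_smul_mem_of_abs_le hzG hw fun i => le_of_mul_le_mul_right ?_ hpos
  rw [mem_closedBall_iff_norm] at hy
  set u := y - (z + ∑ i, (1 / ((d : ℝ) + 1)) • w i)
  rw [← abs_mul, ← htdet]
  calc |b.toBasis.det (Function.update w i u)|
      ≤ ∏ j, ‖Function.update w i u j‖ := b.abs_det_le_prod_norm _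
    _ = ‖u‖ * ∏ j ∈ Finset.univ.erase i, ‖w j‖ := by
      rw [← Finset.mul_prod_erase _ _ (Finset.mem_univ i), Function.update_self]
      congr 1
      refine Finset.prod_congr rfl fun j hj => ?_
      rw [Function.update_of_ne (Finset.ne_of_mem_erase hj)]
    _ ≤ ‖u‖ * ∏ _j ∈ Finset.univ.erase i, (2 * r) := by
      gcongr with j _
      rw [← hdiam]
      simpa using Metric.dist_le_diam_of_mem hb (hw j) hzG
    _ = ‖u‖ * (2 * r) ^ (d - 1) := by simp
    _ ≤ c / (2 ^ (d - 1) * 4 ^ d * ((d : ℝ) + 1) ^ 2) * a * (2 * r) ^ (d - 1) := by gcongr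
    _ = c * r ^ (d - 1) * a / (4 ^ d * ((d : ℝ) + 1) ^ 2) := by
      rw [mul_pow]
      field_simp
    _ ≤ 4 ^ d * |b.toBasis.det w| / (4 ^ d * ((d : ℝ) + 1) ^ 2) := by gcongr
    _ = 1 / ((d : ℝ) + 1) ^ 2 * |b.toBasis.det w| := by field_simp
end

section
/- Let d ≥ 2, let M ≥ 1 be an integer, and let w be a weight on S^{d-1} with w(S^{d-1}) = 1 and w(B) > 0 for every nonempty spherical cap B ⊂ S^{d-1}. Then there exists a convex partition {R_1, …, R_M} of S^{d-1} with w(R_j) = 1/M for every j = 1, …, M. -/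
open MeasureTheory Real Set
open scoped InnerProductSpace

noncomputable section

variable {d : ℕ}

/-- The intersection of the unit sphere of `ℝ^d` with a hyperplane through the origin is null for
the `(d-1)`-dimensional Hausdorff measure. -/
lemma hausdorffMeasure_sphere_inter_hyperplane (hd : 2 ≤ d) {n : EuclideanSpace ℝ (Fin d)}
    (hn : n ≠ 0) :
    Measure.hausdorffMeasure ((d : ℝ) - 1) {x | x ∈ unitSphere d ∧ ⟪n, x⟫_ℝ = 0} = 0 := by
  rcases Set.eq_empty_or_nonempty {x | x ∈ unitSphere d ∧ ⟪n, x⟫_ℝ = 0} with h | ⟨v, hv, hnv⟩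
  · simp [h]
  have hv1 : ‖v‖ = 1 := by simpa [unitSphere] using hv
  have hvv : ⟪v, v⟫_ℝ = 1 := by simp [hv1]
  set K : Submodule ℝ (EuclideanSpace ℝ (Fin d)) := Submodule.span ℝ (Set.range ![n, v]) with hK
  have hli : LinearIndependent ℝ ![n, v] := by
    rw [LinearIndependent.pair_iff]
    intro s t hst
    have h1 := congrArg (fun y => ⟪n, y⟫_ℝ) hst
    have h2 := congrArg (fun y => ⟪v, y⟫_ℝ) hst
    simp only [inner_add_right, inner_smul_right, hnv, real_inner_comm n v, hvv, inner_zero_right,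
      mul_zero, add_zero, zero_add, mul_one] at h1 h2
    refine ⟨?_, h2⟩
    rcases mul_eq_zero.1 h1 with h | h
    · exact h
    · exact absurd (inner_self_eq_zero.1 h) hn
  have hKr : Module.finrank ℝ K = 2 := by
    rw [hK, finrank_span_eq_card hli]; simp
  have hKo : Module.finrank ℝ Kᗮ + 2 = d := by
    have := Submodule.finrank_add_finrank_orthogonal K
    rw [hKr, finrank_euclideanSpace, Fintype.card_fin] at this
    omega
  set F : Kᗮ → EuclideanSpace ℝ (Fin d) := fun y => stereoInvFunAux v (y : EuclideanSpace ℝ (Fin d))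
    with hF
  have hFc : ContDiff ℝ 1 F := contDiff_stereoInvFunAux.comp Kᗮ.subtypeL.contDiff
  have hsub : {x | x ∈ unitSphere d ∧ ⟪n, x⟫_ℝ = 0} ⊆ Set.range F ∪ {v} := by
    rintro x ⟨hx, hnx⟩
    by_cases hxv : x = v
    · exact Or.inr hxv
    left
    have hx1 : ‖x‖ = 1 := by simpa [unitSphere] using hx
    set c := ⟪v, x⟫_ℝ with hc
    have hc1 : 1 - c ≠ 0 := by
      intro h
      exact hxv ((inner_eq_one_iff_of_norm_eq_one hv1 hx1).1 (by rw [← hc]; linarith)).symm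
    have hw : (2 / (1 - c)) • (x - c • v) ∈ Kᗮ := by
      rw [Submodule.mem_orthogonal]
      intro y hy
      rw [hK] at hy
      induction hy using Submodule.span_induction with
      | mem y hy =>
        obtain ⟨i, rfl⟩ := hy
        fin_cases i
        · simp [inner_smul_right, inner_sub_right, hnx, hnv]
        · simp [inner_smul_right, inner_sub_right, ← hc, hv1]
      | zero => simp
      | add a b _ _ ha hb => rw [inner_add_left, ha, hb, add_zero]
      | smul a b _ hb => rw [inner_smul_left, hb, mul_zero]
    refine ⟨⟨_, hw⟩, ?_⟩
    have hnorm : ‖(2 / (1 - c)) • (x - c • v)‖ ^ 2 = 4 * (1 + c) / (1 - c) := by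
      rw [norm_smul, mul_pow, norm_sub_sq_real, norm_smul, inner_smul_right, real_inner_comm, ← hc,
        hx1, hv1, Real.norm_eq_abs, Real.norm_eq_abs, sq_abs, mul_one, sq_abs]
      field_simp
      ring
    simp only [hF, stereoInvFunAux_apply, hnorm]
    have h8 : 4 * (1 + c) / (1 - c) + 4 = 8 / (1 - c) := by field_simp; ring
    have h9 : 4 * (1 + c) / (1 - c) - 4 = 8 * c / (1 - c) := by field_simp; ring
    rw [h8, h9]
    match_scalars <;> field_simp <;> ring
  refine measure_mono_null hsub (measure_union_null ?_ ?_)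
  · have h1 : dimH (Set.range F) < ((d - 1 : ℕ) : NNReal) := by
      refine (hFc.dimH_range_le).trans_lt ?_
      norm_cast
      omega
    have := hausdorffMeasure_of_dimH_lt h1
    rwa [NNReal.coe_natCast, Nat.cast_sub (by omega), Nat.cast_one] at this
  · have : NullSingletonClass (Measure.hausdorffMeasure ((d : ℝ) - 1) :
        Measure (EuclideanSpace ℝ (Fin d))) := by
      refine Measure.nullSingletonClass_hausdorff _ ?_
      have : (2 : ℝ) ≤ d := by exact_mod_cast hd
      linarith
    exact measure_singleton v

/-- The vector `v` rotated by the angle `a` in the oriented plane with basis `u, v`. -/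
def rotNormal (u v : EuclideanSpace ℝ (Fin d)) (a : ℝ) : EuclideanSpace ℝ (Fin d) :=
  cos a • v - sin a • u

/-- The angle in `(0, 2π]` of the projection of `x` to the plane spanned by `u, v`. -/
def polarAngle (u v x : EuclideanSpace ℝ (Fin d)) : ℝ :=
  Complex.arg ⟨-⟪u, x⟫_ℝ, -⟪v, x⟫_ℝ⟩ + π

lemma polarAngle_pos (u v x : EuclideanSpace ℝ (Fin d)) : 0 < polarAngle u v x := by
  have := Complex.neg_pi_lt_arg ⟨-⟪u, x⟫_ℝ, -⟪v, x⟫_ℝ⟩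
  unfold polarAngle
  linarith

lemma polarAngle_le (u v x : EuclideanSpace ℝ (Fin d)) : polarAngle u v x ≤ 2 * π := by
  have := Complex.arg_le_pi ⟨-⟪u, x⟫_ℝ, -⟪v, x⟫_ℝ⟩
  unfold polarAngle
  linarith

lemma measurable_polarAngle (u v : EuclideanSpace ℝ (Fin d)) :
    Measurable (polarAngle u v) := by
  have : polarAngle u v = fun x => Complex.arg (-(⟪u, x⟫_ℝ : ℂ) - ⟪v, x⟫_ℝ * Complex.I) + π := by
    funext x
    unfold polarAngle
    congr 2
    apply Complex.ext <;> simp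
  rw [this]
  refine (Complex.measurable_arg.comp (Continuous.measurable ?_)).add_const _
  fun_prop

lemma inner_rotNormal (u v x : EuclideanSpace ℝ (Fin d)) (a : ℝ) :
    ⟪rotNormal u v a, x⟫_ℝ =
      ‖(⟨-⟪u, x⟫_ℝ, -⟪v, x⟫_ℝ⟩ : ℂ)‖ * sin (polarAngle u v x - a) := by
  have h1 := Complex.norm_mul_cos_arg ⟨-⟪u, x⟫_ℝ, -⟪v, x⟫_ℝ⟩
  have h2 := Complex.norm_mul_sin_arg ⟨-⟪u, x⟫_ℝ, -⟪v, x⟫_ℝ⟩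
  simp only at h1 h2
  rw [polarAngle, Real.sin_sub, Real.sin_add_pi, Real.cos_add_pi, rotNormal, inner_sub_left,
    real_inner_smul_left, real_inner_smul_left]
  linear_combination cos a * h2 - sin a * h1

lemma rotNormal_ne_zero {u v : EuclideanSpace ℝ (Fin d)} (hu : ‖u‖ = 1) (hv : ‖v‖ = 1)
    (huv : ⟪u, v⟫_ℝ = 0) (a : ℝ) : rotNormal u v a ≠ 0 := by
  intro h
  have h1 : ⟪v, rotNormal u v a⟫_ℝ = 0 := by rw [h, inner_zero_right]
  have h2 : ⟪u, rotNormal u v a⟫_ℝ = 0 := by rw [h, inner_zero_right]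
  simp only [rotNormal, inner_sub_right, inner_smul_right, huv, real_inner_comm u v,
    real_inner_self_eq_norm_sq, hu, hv] at h1 h2
  have := Real.sin_sq_add_cos_sq a
  nlinarith

lemma continuous_rotNormal (u v : EuclideanSpace ℝ (Fin d)) : Continuous (rotNormal u v) := by
  unfold rotNormal
  fun_prop

lemma rotNormal_add_pi (u v : EuclideanSpace ℝ (Fin d)) (a : ℝ) :
    rotNormal u v (a + π) = - rotNormal u v a := by
  simp only [rotNormal, Real.cos_add_pi, Real.sin_add_pi]
  module

/-- A point of polar angle `α ∈ [s, t]` lies in the wedge bounded by the directions `s` and `t`. -/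
lemma mem_wedge_of_polarAngle {u v x : EuclideanSpace ℝ (Fin d)} {s t : ℝ} (hst : t ≤ s + π)
    (h1 : s ≤ polarAngle u v x) (h2 : polarAngle u v x ≤ t) :
    0 ≤ ⟪rotNormal u v s, x⟫_ℝ ∧ ⟪rotNormal u v t, x⟫_ℝ ≤ 0 := by
  rw [inner_rotNormal, inner_rotNormal]
  constructor
  · exact mul_nonneg (norm_nonneg _) (sin_nonneg_of_nonneg_of_le_pi (by linarith) (by linarith))
  · exact mul_nonpos_of_nonneg_of_nonpos (norm_nonneg _)
      (sin_nonpos_of_nonpos_of_neg_pi_le (by linarith) (by linarith))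

lemma polarAngle_mem_of_wedge {u v x : EuclideanSpace ℝ (Fin d)} {s t : ℝ} (hs : 0 ≤ s) (hle : s ≤ t)
    (ht : t ≤ 2 * π)
    (h1 : 0 < ⟪rotNormal u v s, x⟫_ℝ) (h2 : ⟪rotNormal u v t, x⟫_ℝ < 0) :
    s < polarAngle u v x ∧ polarAngle u v x ≤ t := by
  rw [inner_rotNormal] at h1 h2
  have hα := polarAngle_pos u v x
  have hα' := polarAngle_le u v x
  have h1' := pos_of_mul_pos_right h1 (norm_nonneg _)
  have h2' : sin (polarAngle u v x - t) < 0 := by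
    by_contra! h
    exact absurd h2 (not_lt.2 (mul_nonneg (norm_nonneg _) h))
  have key : s < polarAngle u v x := by
    by_contra! h
    rcases le_or_gt (-π) (polarAngle u v x - s) with h' | h'
    · exact absurd h1' (not_lt.2 (sin_nonpos_of_nonpos_of_neg_pi_le (by linarith) h'))
    · have : 0 ≤ sin (polarAngle u v x - t + 2 * π) := by
        by_cases hlt : polarAngle u v x - t + 2 * π ≤ π
        · exact sin_nonneg_of_nonneg_of_le_pi (by linarith) hlt
        · exfalso
          linarith
      rw [Real.sin_add_two_pi] at this
      linarith
  refine ⟨key, ?_⟩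
  by_contra! h
  rcases le_or_gt (polarAngle u v x - t) π with h' | h'
  · exact absurd h2' (not_lt.2 (sin_nonneg_of_nonneg_of_le_pi (by linarith) h'))
  · have : 0 ≤ sin (2 * π - (polarAngle u v x - s)) :=
      sin_nonneg_of_nonneg_of_le_pi (by linarith) (by linarith)
    rw [Real.sin_two_pi_sub] at this
    linarith

section Measure

variable {μ : Measure (EuclideanSpace ℝ (Fin d))} {u v : EuclideanSpace ℝ (Fin d)}

lemma wedge_ae_eq (H : ∀ n : EuclideanSpace ℝ (Fin d), n ≠ 0 → ∀ᵐ x ∂μ, ⟪n, x⟫_ℝ ≠ 0)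
    (hu : ‖u‖ = 1) (hv : ‖v‖ = 1) (huv : ⟪u, v⟫_ℝ = 0) {s t : ℝ} (hs : 0 ≤ s) (hle : s ≤ t)
    (ht : t ≤ 2 * π) (hst : t ≤ s + π) :
    {x | 0 ≤ ⟪rotNormal u v s, x⟫_ℝ ∧ ⟪rotNormal u v t, x⟫_ℝ ≤ 0} =ᵐ[μ]
      {x | s < polarAngle u v x ∧ polarAngle u v x ≤ t} := by
  rw [Filter.eventuallyEq_set]
  filter_upwards [H _ (rotNormal_ne_zero hu hv huv s), H _ (rotNormal_ne_zero hu hv huv t)]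
    with x hx1 hx2
  refine ⟨fun ⟨h1, h2⟩ => ?_, fun ⟨h1, h2⟩ => mem_wedge_of_polarAngle hst h1.le h2⟩
  exact polarAngle_mem_of_wedge hs hle ht (lt_of_le_of_ne h1 hx1.symm) (lt_of_le_of_ne h2 hx2)

lemma halfSpace_ae_eq (H : ∀ n : EuclideanSpace ℝ (Fin d), n ≠ 0 → ∀ᵐ x ∂μ, ⟪n, x⟫_ℝ ≠ 0)
    (hu : ‖u‖ = 1) (hv : ‖v‖ = 1) (huv : ⟪u, v⟫_ℝ = 0) {s : ℝ} (hs : 0 ≤ s) (hs' : s ≤ π) :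
    {x | 0 ≤ ⟪rotNormal u v s, x⟫_ℝ} =ᵐ[μ]
      {x | s < polarAngle u v x ∧ polarAngle u v x ≤ s + π} := by
  have := wedge_ae_eq H hu hv huv hs (by linarith [Real.pi_pos] : s ≤ s + π) (by linarith) le_rfl
  simpa only [rotNormal_add_pi, inner_neg_left, neg_nonpos, and_self] using this

variable [IsProbabilityMeasure μ]

lemma continuous_measureReal_halfSpace
    (H : ∀ n : EuclideanSpace ℝ (Fin d), n ≠ 0 → ∀ᵐ x ∂μ, ⟪n, x⟫_ℝ ≠ 0)
    (hu : ‖u‖ = 1) (hv : ‖v‖ = 1) (huv : ⟪u, v⟫_ℝ = 0) :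
    Continuous fun a => μ.real {x | 0 ≤ ⟪rotNormal u v a, x⟫_ℝ} := by
  refine continuous_iff_continuousAt.2 fun a => ?_
  refine (ENNReal.tendsto_toReal (by finiteness)).comp ?_
  refine tendsto_measure_of_ae_tendsto_indicator_of_isFiniteMeasure _ ?_ (fun b => ?_) ?_
  · exact measurableSet_le measurable_const (by fun_prop)
  · exact measurableSet_le measurable_const (by fun_prop)
  filter_upwards [H _ (rotNormal_ne_zero hu hv huv a)] with x hx
  have hc : Continuous fun b => ⟪rotNormal u v b, x⟫_ℝ :=
    (continuous_rotNormal u v).inner continuous_const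
  rcases lt_or_gt_of_ne hx with h | h
  · filter_upwards [hc.continuousAt.eventually_lt continuousAt_const h] with b hb
    exact ⟨fun h' => absurd hb (not_lt.2 h'), fun h' => absurd h (not_lt.2 h')⟩
  · filter_upwards [continuousAt_const.eventually_lt hc.continuousAt h] with b hb
    exact ⟨fun _ => h.le, fun _ => hb.le⟩

lemma continuous_measureReal_polarAngle_le
    (H : ∀ n : EuclideanSpace ℝ (Fin d), n ≠ 0 → ∀ᵐ x ∂μ, ⟪n, x⟫_ℝ ≠ 0)
    (hu : ‖u‖ = 1) (hv : ‖v‖ = 1) (huv : ⟪u, v⟫_ℝ = 0) :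
    Continuous fun a => μ.real {x | polarAngle u v x ≤ a} := by
  refine continuous_iff_continuousAt.2 fun a => ?_
  refine (ENNReal.tendsto_toReal (by finiteness)).comp ?_
  refine tendsto_measure_of_ae_tendsto_indicator_of_isFiniteMeasure _ ?_ (fun b => ?_) ?_
  · exact measurableSet_le (measurable_polarAngle u v) measurable_const
  · exact measurableSet_le (measurable_polarAngle u v) measurable_const
  filter_upwards [H _ (rotNormal_ne_zero hu hv huv a)] with x hx
  have hne : polarAngle u v x ≠ a := by
    rintro rfl
    exact hx (by rw [inner_rotNormal, sub_self, Real.sin_zero, mul_zero])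
  rcases lt_or_gt_of_ne hne with h | h
  · filter_upwards [lt_mem_nhds h] with b hb
    exact ⟨fun _ => h.le, fun _ => le_of_lt hb⟩
  · filter_upwards [gt_mem_nhds h] with b hb
    exact ⟨fun h' => absurd hb (not_lt.2 h'), fun h' => absurd h (not_lt.2 h')⟩

/-- Some half-space whose boundary contains the orthogonal complement of the plane of `u, v` has
mass `c ≤ 1/2`, unless all of them have larger mass. -/
lemma exists_halfSpace_or_forall
    (H : ∀ n : EuclideanSpace ℝ (Fin d), n ≠ 0 → ∀ᵐ x ∂μ, ⟪n, x⟫_ℝ ≠ 0)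
    (hu : ‖u‖ = 1) (hv : ‖v‖ = 1) (huv : ⟪u, v⟫_ℝ = 0) {c : ℝ} (hc : c ≤ 1 / 2) :
    (∃ a, μ.real {x | 0 ≤ ⟪rotNormal u v a, x⟫_ℝ} = c) ∨
      ∀ a, c < μ.real {x | 0 ≤ ⟪rotNormal u v a, x⟫_ℝ} := by
  by_cases hall : ∀ a, c < μ.real {x | 0 ≤ ⟪rotNormal u v a, x⟫_ℝ}
  · exact Or.inr hall
  push Not at hall
  left
  refine mem_range_of_exists_le_of_exists_ge (continuous_measureReal_halfSpace H hu hv huv) hall ?_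
  by_contra! hlt
  have h0 := hlt 0
  have h1 := hlt (0 + π)
  have hcov : {x | 0 ≤ ⟪rotNormal u v 0, x⟫_ℝ} ∪ {x | 0 ≤ ⟪rotNormal u v (0 + π), x⟫_ℝ} = univ := by
    ext x
    simp only [rotNormal_add_pi, inner_neg_left, neg_nonneg, mem_union, mem_ofPred_eq, mem_univ,
      iff_true]
    exact le_total _ _
  have h2 := measureReal_union_le (μ := μ) {x | 0 ≤ ⟪rotNormal u v 0, x⟫_ℝ}
    {x | 0 ≤ ⟪rotNormal u v (0 + π), x⟫_ℝ}
  rw [hcov, probReal_univ] at h2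
  linarith

lemma measureReal_polarAngle_Ioc {s t : ℝ} (hst : s ≤ t) :
    μ.real {x | s < polarAngle u v x ∧ polarAngle u v x ≤ t} =
      μ.real {x | polarAngle u v x ≤ t} - μ.real {x | polarAngle u v x ≤ s} := by
  have hsub : {x | polarAngle u v x ≤ s} ⊆ {x | polarAngle u v x ≤ t} := fun x (hx : _ ≤ s) =>
    hx.trans hst
  rw [← measureReal_sdiff hsub
    (measurableSet_le (measurable_polarAngle u v) measurable_const)]
  congr 1
  ext x
  simp [and_comm]

/-- There are angles `0 = T 0 ≤ T 1 ≤ ... ≤ T M = 2π`, consecutive ones at distance at most `π`,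
which cut the space into `M` wedges of equal mass, provided that either the first half-space has
mass `1/M` or all half-spaces have larger mass. -/
lemma exists_angles_of_halfSpace
    (H : ∀ n : EuclideanSpace ℝ (Fin d), n ≠ 0 → ∀ᵐ x ∂μ, ⟪n, x⟫_ℝ ≠ 0)
    (hu : ‖u‖ = 1) (hv : ‖v‖ = 1) (huv : ⟪u, v⟫_ℝ = 0) {M : ℕ} (hM : 2 ≤ M)
    (hcase : μ.real {x | 0 ≤ ⟪rotNormal u v 0, x⟫_ℝ} = 1 / M ∨
      ∀ a, 1 / (M : ℝ) < μ.real {x | 0 ≤ ⟪rotNormal u v a, x⟫_ℝ}) :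
    ∃ T : ℕ → ℝ, T 0 = 0 ∧ T M = 2 * π ∧ ∀ k < M, 0 ≤ T k ∧ T k ≤ T (k + 1) ∧ T (k + 1) ≤ 2 * π ∧
      T (k + 1) ≤ T k + π ∧
      μ.real {x | T k < polarAngle u v x ∧ polarAngle u v x ≤ T (k + 1)} = 1 / M := by
  have hM0 : (0 : ℝ) < M := by positivity
  have hπ := Real.pi_pos
  set G : ℝ → ℝ := fun a => μ.real {x | polarAngle u v x ≤ a} with hG
  have hGc : Continuous G := continuous_measureReal_polarAngle_le H hu hv huv
  have hGm : Monotone G := fun a b hab => measureReal_mono fun x (hx : _ ≤ a) => hx.trans hab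
  have hG0 : G 0 = 0 := by
    have : {x | polarAngle u v x ≤ 0} = ∅ := by
      ext x
      simpa using polarAngle_pos u v x
    simp [hG, this]
  have hG1 : G (2 * π) = 1 := by
    have : {x | polarAngle u v x ≤ 2 * π} = univ := by
      ext x
      simpa using polarAngle_le u v x
    simp [hG, this]
  have hhalf : ∀ s, 0 ≤ s → s ≤ π →
      μ.real {x | 0 ≤ ⟪rotNormal u v s, x⟫_ℝ} = G (s + π) - G s := fun s h0 h1 => by
    rw [measureReal_congr (halfSpace_ae_eq H hu hv huv h0 h1),
      measureReal_polarAngle_Ioc (by linarith)]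
  have hex : ∀ k : ℕ, ∃ t : ℝ, k ≤ M → (0 ≤ t ∧ t ≤ 2 * π ∧ G t = k / M ∧ (k = 0 → t = 0) ∧
      (k = M → t = 2 * π) ∧ (k = 1 → G π = 1 / M → t = π)) := by
    intro k
    by_cases hk : k ≤ M
    swap
    · exact ⟨0, fun h => absurd h hk⟩
    rcases eq_or_ne k 0 with rfl | hk0
    · exact ⟨0, fun _ => ⟨le_rfl, by linarith, by simp [hG0], fun _ => rfl, by omega, by omega⟩⟩
    rcases eq_or_ne k M with rfl | hkM
    · exact ⟨2 * π, fun _ => ⟨by linarith, le_rfl, by rw [hG1, div_self hM0.ne'], by omega,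
        fun _ => rfl, by omega⟩⟩
    by_cases hk1 : k = 1 ∧ G π = 1 / M
    · obtain ⟨rfl, h⟩ := hk1
      exact ⟨π, fun _ => ⟨hπ.le, by linarith, by simpa using h, by omega, by omega, fun _ _ => rfl⟩⟩
    · obtain ⟨t, ht, hGt⟩ : (k / M : ℝ) ∈ G '' Icc 0 (2 * π) := by
        refine intermediate_value_Icc (by linarith) hGc.continuousOn ?_
        rw [hG0, hG1]
        exact ⟨by positivity, div_le_one_of_le₀ (by exact_mod_cast hk) hM0.le⟩
      exact ⟨t, fun _ => ⟨ht.1, ht.2, hGt, by omega, by omega, fun h h' => absurd ⟨h, h'⟩ hk1⟩⟩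
  choose T hT using hex
  refine ⟨T, (hT 0 (by omega)).2.2.2.1 rfl, (hT M le_rfl).2.2.2.2.1 rfl, fun k hk => ?_⟩
  obtain ⟨h0, -, hGk, hk0, -, hk1⟩ := hT k hk.le
  obtain ⟨-, h2, hGk', -, -, hk1'⟩ := hT (k + 1) hk
  have hGdiff : G (T (k + 1)) - G (T k) = 1 / M := by
    rw [hGk, hGk']
    push_cast
    ring
  have hpos : 0 < 1 / (M : ℝ) := by positivity
  have hle : T k ≤ T (k + 1) := by
    by_contra! h
    linarith [hGm h.le]
  refine ⟨h0, hle, h2, ?_, by rw [measureReal_polarAngle_Ioc hle]; exact hGdiff⟩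
  rcases hcase with hA | hB
  · rw [hhalf 0 le_rfl hπ.le, zero_add, hG0, sub_zero] at hA
    rcases Nat.eq_zero_or_pos k with rfl | hkpos
    · rw [hk0 rfl, hk1' rfl hA, zero_add]
    · have : π ≤ T k := by
        rcases eq_or_ne k 1 with rfl | hne
        · rw [hk1 rfl hA]
        · by_contra! h
          have hlt : (1 : ℝ) / M < k / M := by
            have : (1 : ℝ) < k := by exact_mod_cast (by omega : 1 < k)
            gcongr
          linarith [hGm h.le]
      linarith
  · by_contra! h
    have h3 := hB (T k)
    rw [hhalf _ h0 (by linarith)] at h3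
    linarith [hGm h.le]

lemma exists_equal_mass_angles
    (H : ∀ n : EuclideanSpace ℝ (Fin d), n ≠ 0 → ∀ᵐ x ∂μ, ⟪n, x⟫_ℝ ≠ 0)
    (hu : ‖u‖ = 1) (hv : ‖v‖ = 1) (huv : ⟪u, v⟫_ℝ = 0) {M : ℕ} (hM : 2 ≤ M) :
    ∃ u v : EuclideanSpace ℝ (Fin d), ‖u‖ = 1 ∧ ‖v‖ = 1 ∧ ⟪u, v⟫_ℝ = 0 ∧
    ∃ T : ℕ → ℝ, T 0 = 0 ∧ T M = 2 * π ∧ ∀ k < M, 0 ≤ T k ∧ T k ≤ T (k + 1) ∧ T (k + 1) ≤ 2 * π ∧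
      T (k + 1) ≤ T k + π ∧
      μ.real {x | T k < polarAngle u v x ∧ polarAngle u v x ≤ T (k + 1)} = 1 / M := by
  have hc : 1 / (M : ℝ) ≤ 1 / 2 := by
    have : (2 : ℝ) ≤ M := by exact_mod_cast hM
    gcongr
  rcases exists_halfSpace_or_forall H hu hv huv hc with ⟨a, ha⟩ | hall
  · have hsc := Real.sin_sq_add_cos_sq a
    have huu : ⟪u, u⟫_ℝ = 1 := by simp [hu]
    have hvv : ⟪v, v⟫_ℝ = 1 := by simp [hv]
    have hvu : ⟪v, u⟫_ℝ = 0 := by rw [real_inner_comm, huv]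
    have hu' : ‖cos a • u + sin a • v‖ = 1 := by
      rw [norm_eq_sqrt_real_inner, Real.sqrt_eq_one]
      simp only [inner_add_left, inner_add_right, real_inner_smul_left, real_inner_smul_right, huu,
        hvv, huv, hvu]
      linear_combination hsc
    have hv' : ‖rotNormal u v a‖ = 1 := by
      rw [norm_eq_sqrt_real_inner, Real.sqrt_eq_one]
      simp only [rotNormal, inner_sub_left, inner_sub_right, real_inner_smul_left,
        real_inner_smul_right, huu, hvv, huv, hvu]
      linear_combination hsc
    have huv' : ⟪cos a • u + sin a • v, rotNormal u v a⟫_ℝ = 0 := by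
      simp only [rotNormal, inner_add_left, inner_sub_right, real_inner_smul_left,
        real_inner_smul_right, huu, hvv, huv, hvu]
      ring
    refine ⟨_, _, hu', hv', huv', exists_angles_of_halfSpace H hu' hv' huv' hM (Or.inl ?_)⟩
    rw [← ha]
    simp [rotNormal]
  · exact ⟨u, v, hu, hv, huv, exists_angles_of_halfSpace H hu hv huv hM (Or.inr hall)⟩

end Measure

lemma geoConvex_wedge (n m : EuclideanSpace ℝ (Fin d)) :
    GeoConvex {x | x ∈ unitSphere d ∧ 0 ≤ ⟪n, x⟫_ℝ ∧ ⟪m, x⟫_ℝ ≤ 0} := by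
  rintro x ⟨-, hx1, hx2⟩ y ⟨-, hy1, hy2⟩ z ⟨hz, a, b, ha, hb, rfl⟩
  refine ⟨hz, ?_, ?_⟩
  · rw [inner_add_right, real_inner_smul_right, real_inner_smul_right]
    positivity
  · rw [inner_add_right, real_inner_smul_right, real_inner_smul_right]
    exact add_nonpos (mul_nonpos_of_nonneg_of_nonpos ha hx2)
      (mul_nonpos_of_nonneg_of_nonpos hb hy2)

lemma isClosed_wedge (n m : EuclideanSpace ℝ (Fin d)) :
    IsClosed {x | x ∈ unitSphere d ∧ 0 ≤ ⟪n, x⟫_ℝ ∧ ⟪m, x⟫_ℝ ≤ 0} := by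
  have h1 : IsClosed {x | 0 ≤ ⟪n, x⟫_ℝ} := isClosed_le continuous_const (by fun_prop)
  have h2 : IsClosed {x | ⟪m, x⟫_ℝ ≤ 0} := isClosed_le (by fun_prop) continuous_const
  exact Metric.isClosed_sphere.inter (h1.inter h2)

lemma cap_subset_closedBall {x : EuclideanSpace ℝ (Fin d)} (hx : x ∈ unitSphere d) {r : ℝ}
    (hr : 0 ≤ r) (hr' : r ≤ π) : cap x r ⊆ Metric.closedBall x r := by
  rintro y ⟨hy, hxy⟩
  have hx1 : ‖x‖ = 1 := by simpa [unitSphere] using hx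
  have hy1 : ‖y‖ = 1 := by simpa [unitSphere] using hy
  have hin : |⟪x, y⟫_ℝ| ≤ 1 := by simpa [hx1, hy1] using abs_real_inner_le_norm x y
  have hcos : cos r ≤ ⟪x, y⟫_ℝ := by
    rw [← Real.cos_arccos (abs_le.1 hin).1 (abs_le.1 hin).2]
    exact Real.cos_le_cos_of_nonneg_of_le_pi (Real.arccos_nonneg _) hr' hxy
  have h2 := Real.one_sub_sq_div_two_le_cos (x := r)
  have h3 := norm_sub_sq_real y x
  rw [hx1, hy1, real_inner_comm] at h3
  rw [mem_closedBall_iff_norm]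
  exact abs_le_of_sq_le_sq' (by linarith) hr |>.2

/-- Integration against a nonnegative integrable weight is evaluation of the measure with that
density. -/
lemma wMass_eq_measureReal {w : EuclideanSpace ℝ (Fin d) → ℝ} (hw0 : ∀ x, 0 ≤ w x)
    (hwi : Integrable w (sphMeasure d)) {A : Set (EuclideanSpace ℝ (Fin d))}
    (hA : MeasurableSet A) :
    wMass w A = ((sphMeasure d).withDensity fun x => ENNReal.ofReal (w x)).real A := by
  rw [wMass, Measure.real, withDensity_apply _ hA,
    integral_eq_lintegral_of_nonneg_ae (Filter.Eventually.of_forall hw0)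
      hwi.restrict.aestronglyMeasurable]

lemma isClosed_unitSphere : IsClosed (unitSphere d) := Metric.isClosed_sphere

lemma isClosed_cap (x : EuclideanSpace ℝ (Fin d)) (r : ℝ) : IsClosed (cap x r) :=
  isClosed_unitSphere.inter (isClosed_le (Real.continuous_arccos.comp (by fun_prop))
    continuous_const)

lemma sphInterior_inter_eq_empty {w : EuclideanSpace ℝ (Fin d) → ℝ} (hw0 : ∀ x, 0 ≤ w x)
    (hwi : Integrable w (sphMeasure d))
    (hpos : ∀ x ∈ unitSphere d, ∀ r : ℝ, 0 < r → 0 < wMass w (cap x r))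
    {A B : Set (EuclideanSpace ℝ (Fin d))} (hA : A ⊆ unitSphere d)
    (hAB : ((sphMeasure d).withDensity fun x => ENNReal.ofReal (w x)) (A ∩ B) = 0) :
    sphInterior A ∩ sphInterior B = ∅ := by
  rw [Set.eq_empty_iff_forall_notMem]
  rintro x ⟨⟨hxA, ε, hε, hεA⟩, -, δ, hδ, hδB⟩
  have hx := hA hxA
  set r := min (min ε δ / 2) π
  have hr : 0 < r := lt_min (by positivity) Real.pi_pos
  have hrlt : r < min ε δ := (min_le_left _ _).trans_lt (half_lt_self (lt_min hε hδ))
  have hsub : cap x r ⊆ A ∩ B := fun y hy => by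
    have hyr := cap_subset_closedBall hx hr.le (min_le_right _ _) hy
    exact ⟨hεA ⟨Metric.closedBall_subset_ball (hrlt.trans_le (min_le_left _ _)) hyr, hy.1⟩,
      hδB ⟨Metric.closedBall_subset_ball (hrlt.trans_le (min_le_right _ _)) hyr, hy.1⟩⟩
  have h := hpos x hx r hr
  rw [wMass_eq_measureReal hw0 hwi (isClosed_cap x r).measurableSet, Measure.real,
    measure_mono_null hsub hAB] at h
  simp at h

/-- Convex equal-mass partitions of the weighted sphere. -/
theorem equal_mass_convex_partition (d : ℕ) (hd : 2 ≤ d) (M : ℕ) (hM : 1 ≤ M)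
    (w : EuclideanSpace ℝ (Fin d) → ℝ)
    (hw0 : ∀ x, 0 ≤ w x) (hwi : Integrable w (sphMeasure d))
    (hnorm : wMass w (unitSphere d) = 1)
    (hpos : ∀ x ∈ unitSphere d, ∀ r : ℝ, 0 < r → 0 < wMass w (cap x r)) :
    ∃ R : Fin M → Set (EuclideanSpace ℝ (Fin d)),
      (∀ j, IsClosed (R j)) ∧
      (∀ j, GeoConvex (R j)) ∧
      (⋃ j, R j) = unitSphere d ∧
      (∀ i j, i ≠ j → sphInterior (R i) ∩ sphInterior (R j) = ∅) ∧
      ∀ j, wMass w (R j) = 1 / (M : ℝ) := by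
  rcases hM.eq_or_lt with rfl | hM2
  · exact ⟨fun _ => unitSphere d, fun _ => isClosed_unitSphere, fun _ => fun _ _ _ _ _ hz => hz.1,
      iUnion_const _, fun i j hij => absurd (Subsingleton.elim i j) hij, fun _ => by simp [hnorm]⟩
  set μ := (sphMeasure d).withDensity fun x => ENNReal.ofReal (w x) with hμ
  have hac : μ ≪ sphMeasure d := withDensity_absolutelyContinuous _ _
  have hsph : ∀ᵐ x ∂μ, x ∈ unitSphere d :=
    hac.ae_le (ae_restrict_mem isClosed_unitSphere.measurableSet)
  have hprob : IsProbabilityMeasure μ := by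
    refine ⟨?_⟩
    rw [wMass_eq_measureReal hw0 hwi isClosed_unitSphere.measurableSet, Measure.real,
      ENNReal.toReal_eq_one_iff] at hnorm
    rw [← hnorm]
    exact (measure_congr (Filter.eventuallyEq_univ.2 hsph)).symm
  have H : ∀ n : EuclideanSpace ℝ (Fin d), n ≠ 0 → ∀ᵐ x ∂μ, ⟪n, x⟫_ℝ ≠ 0 := by
    intro n hn
    suffices h : ∀ᵐ x ∂(sphMeasure d), ⟪n, x⟫_ℝ ≠ 0 from hac.ae_le h
    rw [sphMeasure, ae_restrict_iff' isClosed_unitSphere.measurableSet, ae_iff]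
    convert hausdorffMeasure_sphere_inter_hyperplane hd hn using 2
    ext x
    simp
  obtain ⟨u, v, hu, hv, huv, T, hT0, hTM, hT⟩ := exists_equal_mass_angles H
    (u := EuclideanSpace.single (⟨0, by omega⟩ : Fin d) 1)
    (v := EuclideanSpace.single (⟨1, by omega⟩ : Fin d) 1)
    (by simp) (by simp) (by simp [EuclideanSpace.inner_single_left]) hM2
  set R : ℕ → Set (EuclideanSpace ℝ (Fin d)) := fun k =>
    {x | x ∈ unitSphere d ∧ 0 ≤ ⟪rotNormal u v (T k), x⟫_ℝ ∧ ⟪rotNormal u v (T (k + 1)), x⟫_ℝ ≤ 0}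
    with hR
  have hRae : ∀ k < M, R k =ᵐ[μ] {x | T k < polarAngle u v x ∧ polarAngle u v x ≤ T (k + 1)} := by
    intro k hk
    obtain ⟨h0, h1, h2, h3, -⟩ := hT k hk
    exact (inter_ae_eq_right_of_ae_eq_univ (Filter.eventuallyEq_univ.2 hsph)).trans
      (wedge_ae_eq H hu hv huv h0 h1 h2 h3)
  have hmono : ∀ i j, i ≤ j → j ≤ M → T i ≤ T j := by
    intro i j hij
    induction j, hij using Nat.le_induction with
    | base => exact fun _ => le_rfl
    | succ j _ ih => exact fun hj => (ih (by omega)).trans (hT j hj).2.1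
  have hnull : ∀ i j, i < j → j < M → μ (R i ∩ R j) = 0 := by
    intro i j hij hj
    rw [measure_congr ((hRae i (hij.trans hj)).inter (hRae j hj))]
    convert measure_empty (μ := μ)
    rw [Set.eq_empty_iff_forall_notMem]
    rintro x ⟨⟨-, h1⟩, h2, -⟩
    exact absurd (h2.trans_le h1) (not_lt.2 (hmono (i + 1) j hij hj.le))
  refine ⟨fun j => R j, fun j => isClosed_wedge _ _, fun j => geoConvex_wedge _ _, ?_, ?_, ?_⟩
  · refine Subset.antisymm (iUnion_subset fun j x hx => hx.1) fun x hx => ?_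
    have hex : ∃ k, polarAngle u v x ≤ T k := ⟨M, by rw [hTM]; exact polarAngle_le u v x⟩
    classical
    have hk := Nat.find_spec hex
    have hkM : Nat.find hex ≤ M := Nat.find_min' hex (by rw [hTM]; exact polarAngle_le u v x)
    obtain ⟨k, hk'⟩ : ∃ k, Nat.find hex = k + 1 := by
      refine Nat.exists_eq_succ_of_ne_zero fun h => ?_
      rw [h, hT0] at hk
      exact absurd hk (not_le.2 (polarAngle_pos u v x))
    have hlt := Nat.find_min hex (m := k) (by omega)
    rw [hk'] at hk hkM
    exact mem_iUnion.2 ⟨⟨k, hkM⟩, hx, mem_wedge_of_polarAngle (hT k hkM).2.2.2.1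
      (not_le.1 hlt).le hk⟩
  · intro i j hij
    refine sphInterior_inter_eq_empty hw0 hwi hpos (fun x hx => hx.1) ?_
    rcases lt_or_gt_of_ne (Fin.val_ne_of_ne hij) with h | h
    · exact hnull i j h j.2
    · rw [inter_comm]
      exact hnull j i h i.2
  · intro j
    rw [wMass_eq_measureReal hw0 hwi (isClosed_wedge _ _).measurableSet, ← hμ,
      measureReal_congr (hRae j j.2)]
    exact (hT j j.2).2.2.2.2
end
end

section
/- Let d ≥ 2, ε ∈ (0,1), and let η_1, …, η_d ∈ S^{d-1} be strongly ε-separated. Let A be the d×d real matrix whose columns are η_1, …, η_d. Then for every x ∈ ℝ^d: (ε/√d)·‖x‖ ≤ ‖Ax‖ ≤ √d·‖x‖. -/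
open MeasureTheory Real Set
open scoped InnerProductSpace

noncomputable section

variable {d : ℕ}

theorem mul_abs_coeff_le_norm_sum {ι E : Type*} [Fintype ι] [NormedAddCommGroup E]
    [NormedSpace ℝ E] {ε : ℝ} {v : ι → E} {j : ι}
    (h : ∀ y ∈ Submodule.span ℝ (v '' {i | i ≠ j}), ε ≤ ‖v j - y‖) (c : ι → ℝ) :
    ε * |c j| ≤ ‖∑ i, c i • v i‖ := by
  classical
  rcases eq_or_ne (c j) 0 with hc | hc
  · simp [hc]
  set s : E := ∑ i ∈ Finset.univ.erase j, c i • v i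
  have hs : s ∈ Submodule.span ℝ (v '' {i | i ≠ j}) :=
    Submodule.sum_mem _ fun i hi =>
      Submodule.smul_mem _ _ (Submodule.subset_span ⟨i, Finset.ne_of_mem_erase hi, rfl⟩)
  have hsum : ∑ i, c i • v i = c j • (v j - (-(c j)⁻¹) • s) := by
    rw [← Finset.add_sum_erase _ _ (Finset.mem_univ j), smul_sub, smul_smul, mul_neg,
      mul_inv_cancel₀ hc, neg_one_smul, sub_neg_eq_add]
  rw [hsum, norm_smul, Real.norm_eq_abs, mul_comm]
  exact mul_le_mul_of_nonneg_left (h _ (Submodule.smul_mem _ _ hs)) (abs_nonneg _)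

theorem EuclideanSpace.norm_le_sqrt_card_mul {ι : Type*} [Fintype ι] {x : EuclideanSpace ℝ ι}
    {C : ℝ} (hC : 0 ≤ C) (h : ∀ i, |x i| ≤ C) : ‖x‖ ≤ √(Fintype.card ι) * C := by
  rw [EuclideanSpace.norm_eq, Real.sqrt_le_left (by positivity), mul_pow,
    Real.sq_sqrt (by positivity)]
  simpa using Finset.sum_le_card_nsmul Finset.univ (fun i => ‖x i‖ ^ 2) (C ^ 2)
    fun i _ => pow_le_pow_left₀ (norm_nonneg _) (h i) 2

theorem EuclideanSpace.sum_abs_le_sqrt_card_mul_norm {ι : Type*} [Fintype ι]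
    (x : EuclideanSpace ℝ ι) : ∑ i, |x i| ≤ √(Fintype.card ι) * ‖x‖ := by
  rw [EuclideanSpace.norm_eq, ← Real.sqrt_mul (by positivity)]
  apply Real.le_sqrt_of_sq_le
  simpa using sq_sum_le_card_mul_sum_sq (s := Finset.univ) (f := fun i => |x i|)

/-- Norm bounds for the matrix whose columns form a strongly
`ε`-separated subset of the sphere. -/
theorem strongly_separated_matrix_bounds (d : ℕ) (hd : 2 ≤ d) (ε : ℝ)
    (hε : ε ∈ Set.Ioo (0 : ℝ) 1) (η : Fin d → EuclideanSpace ℝ (Fin d))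
    (hsep : StronglySep ε η) (x : EuclideanSpace ℝ (Fin d)) :
    ε / Real.sqrt d * ‖x‖ ≤ ‖∑ j, x j • η j‖ ∧
      ‖∑ j, x j • η j‖ ≤ Real.sqrt d * ‖x‖ := by
  have hε0 : 0 < ε := hε.1
  obtain ⟨-, hunit, hspan⟩ := hsep
  have hnorm : ∀ j, ‖η j‖ = 1 := fun j => mem_sphere_zero_iff_norm.1 (hunit j)
  constructor
  · have hd0 : 0 < Real.sqrt d := Real.sqrt_pos.2 (by exact_mod_cast (by lia : 0 < d))
    have hx := EuclideanSpace.norm_le_sqrt_card_mul (x := x)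
      (div_nonneg (norm_nonneg (∑ j, x j • η j)) hε0.le) fun j => by
        rw [le_div_iff₀' hε0]
        exact mul_abs_coeff_le_norm_sum (hspan j) x
    rw [Fintype.card_fin, ← mul_div_assoc, le_div_iff₀' hε0] at hx
    rwa [div_mul_eq_mul_div, div_le_iff₀' hd0]
  · calc ‖∑ j, x j • η j‖ ≤ ∑ j, ‖x j • η j‖ := norm_sum_le _ _
      _ = ∑ j, |x j| := by simp [norm_smul, hnorm]
      _ ≤ Real.sqrt d * ‖x‖ := by
        simpa using EuclideanSpace.sum_abs_le_sqrt_card_mul_norm x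
end
end

section
/- Let d ≥ 2, ε ∈ (0,1), and let η_1, …, η_d ∈ S^{d-1} be strongly ε-separated. Then every point x of the Euclidean convex hull of {η_1, …, η_d} satisfies ‖x‖ ≥ ε/d. -/
open MeasureTheory Real Set
open scoped InnerProductSpace

noncomputable section

variable {d : ℕ}

/-- A linear combination of a family is bounded below by each coefficient times the distance of the
corresponding vector to the span of the others. -/
theorem mul_le_norm_sum_smul_of_le_norm_sub {ι E : Type*} [NormedAddCommGroup E] [NormedSpace ℝ E]
    {v : ι → E} {j : ι} {ε : ℝ} (hv : ∀ y ∈ Submodule.span ℝ (v '' {i | i ≠ j}), ε ≤ ‖v j - y‖)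
    {s : Finset ι} (hj : j ∈ s) {w : ι → ℝ} (hw : 0 < w j) :
    w j * ε ≤ ‖∑ i ∈ s, w i • v i‖ := by
  classical
  set z := ∑ i ∈ s.erase j, w i • v i with hz
  have hzmem : z ∈ Submodule.span ℝ (v '' {i | i ≠ j}) :=
    Submodule.sum_mem _ fun i hi => Submodule.smul_mem _ _ <|
      Submodule.subset_span ⟨i, Finset.ne_of_mem_erase hi, rfl⟩
  have hsum : ∑ i ∈ s, w i • v i = w j • (v j - (-(w j)⁻¹) • z) := by
    rw [← Finset.add_sum_erase s _ hj, ← hz, smul_sub, smul_smul, mul_neg,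
      mul_inv_cancel₀ hw.ne', neg_one_smul, sub_neg_eq_add]
  rw [hsum, norm_smul, Real.norm_of_nonneg hw.le]
  exact mul_le_mul_of_nonneg_left (hv _ (Submodule.smul_mem _ _ hzmem)) hw.le

/-- The convex hull of a strongly `ε`-separated subset of the sphere
stays at distance at least `ε/d` from the origin. -/
theorem strongly_separated_hull_bound (d : ℕ) (hd : 2 ≤ d) (ε : ℝ)
    (hε : ε ∈ Set.Ioo (0 : ℝ) 1) (η : Fin d → EuclideanSpace ℝ (Fin d))
    (hsep : StronglySep ε η) (x : EuclideanSpace ℝ (Fin d))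
    (hx : x ∈ convexHull ℝ (Set.range η)) :
    ε / d ≤ ‖x‖ := by
  obtain ⟨-, -, hdist⟩ := hsep
  have hd0 : (0 : ℝ) < d := by exact_mod_cast (by omega : 0 < d)
  rw [convexHull_range_eq_exists_affineCombination] at hx
  obtain ⟨s, w, -, hw1, rfl⟩ := hx
  rw [s.affineCombination_eq_linear_combination _ _ hw1]
  have hs : s.Nonempty := Finset.nonempty_of_sum_ne_zero (hw1.trans_ne one_ne_zero)
  have hcard : (s.card : ℝ) ≤ d := by
    exact_mod_cast s.card_le_univ.trans_eq (Fintype.card_fin d)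
  obtain ⟨j, hj, hjw⟩ : ∃ j ∈ s, (1 : ℝ) / d ≤ w j := by
    refine Finset.exists_le_of_sum_le hs ?_
    rw [hw1, Finset.sum_const, nsmul_eq_mul, mul_one_div]
    exact (div_le_one hd0).2 hcard
  calc
    ε / d = 1 / d * ε := by ring
    _ ≤ w j * ε := mul_le_mul_of_nonneg_right hjw hε.1.le
    _ ≤ _ := mul_le_norm_sum_smul_of_le_norm_sub (hdist j) hj ((one_div_pos.2 hd0).trans_le hjw)
end
end
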